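/- For every ξ ∈ V_reg := {ξ ∈ V : ⟨ξ,α⟩ ∉ 2πℤ for all α ∈ R₀⁺}, the function φ_ξ := ∑_{v∈W₀} T_v e^{iξ} ∈ 𝒞(P) admits the plane-wave decomposition φ_ξ = ∑_{w∈W₀} C(wξ) e^{iwξ}, where C(ξ) = ∏_{α∈R₀⁺}(1 − t_α e^{−i⟨ξ,α⟩})/(1 − e^{−i⟨ξ,α⟩}). In particular, φ_ξ(λ) = M_λ(ξ) for every λ ∈ P⁺ and ξ ∈ V_reg. -/

import Mathlib

noncomputable section

open scoped RealInnerProductSpace BigOperators Classical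
open Filter

namespace AffinePieri

variable {V : Type*} [NormedAddCommGroup V] [InnerProductSpace ℝ V] [FiniteDimensional ℝ V]

/-- The coroot `α^∨ = 2α/⟨α,α⟩` of a vector `α`. -/
def coroot (α : V) : V := (2 / ⟪α, α⟫) • α

lemma refl_involutive (α : V) (k : ℝ) :
    Function.Involutive (fun x : V => x - (⟪x, coroot α⟫ + k) • α) := by
  intro x
  by_cases h : α = 0
  · simp [h, coroot]
  · have hαα : ⟪α, α⟫ ≠ 0 := fun hc => h (inner_self_eq_zero.mp hc)
    have h2 : ⟪α, coroot α⟫ = 2 := by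
      rw [coroot, real_inner_smul_right]
      field_simp
    show (x - (⟪x, coroot α⟫ + k) • α) -
        (⟪x - (⟪x, coroot α⟫ + k) • α, coroot α⟫ + k) • α = x
    rw [inner_sub_left, real_inner_smul_left, h2]
    have key : (⟪x, coroot α⟫ + k) +
        (⟪x, coroot α⟫ - (⟪x, coroot α⟫ + k) * 2 + k) = 0 := by ring
    rw [sub_sub, ← add_smul, key, zero_smul, sub_zero]

/-- The (affine) orthogonal reflection `x ↦ x - (⟨x,α^∨⟩ + k)α` as a permutation of `V`. -/
def reflP (α : V) (k : ℝ) : Equiv.Perm V :=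
  Function.Involutive.toPerm _ (refl_involutive α k)

@[simp] lemma reflP_apply (α : V) (k : ℝ) (x : V) :
    reflP α k x = x - (⟪x, coroot α⟫ + k) • α := rfl

/-- The sign of a real number, as an integer. -/
def zsgn (v : ℝ) : ℤ := if 0 < v then 1 else if v < 0 then -1 else 0

/-- Alternating composition `f ∘ g ∘ f ∘ ⋯` with `m` factors, used for braid relations. -/
def altOp {A : Type*} (f g : A → A) : ℕ → A → A
  | 0 => id
  | (k + 1) => f ∘ altOp g f k

/-- The interaction potential `v_α` entering the Morse (fusion) potential, for a
parameter family `s`. -/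
def vintOf (s : V → ℝ) (α : V) (x : ℝ) : ℝ :=
  (1 - s α ^ 2) * ∫ y in (0:ℝ)..x, 1 / (1 - 2 * s α * Real.cos y + s α ^ 2)

/-- All the standing data of the paper: an irreducible reduced crystallographic root
system `R₀` spanning the Euclidean space `V`, with a positive system, simple roots,
highest (short) roots, an admissible pair `(R₀, R̂₀)` encoded by the map `hat` and the
affine root `α₀`, a `W₀`-invariant multiplicity function `t` with values in `(-1,1)`,
and an integral level `c > 1`. -/
structure Setup (V : Type*) [NormedAddCommGroup V] [InnerProductSpace ℝ V]
    [FiniteDimensional ℝ V] where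
  n : ℕ
  npos : 0 < n
  hdim : Module.finrank ℝ V = n
  R0 : Finset V
  zero_not_mem : (0 : V) ∉ R0
  span_top : Submodule.span ℝ (R0 : Set V) = ⊤
  cryst : ∀ α ∈ R0, ∀ β ∈ R0, ∃ k : ℤ, ⟪β, coroot α⟫ = (k : ℝ)
  refl_mem : ∀ α ∈ R0, ∀ β ∈ R0, β - ⟪β, coroot α⟫ • α ∈ R0
  reduced : ∀ α ∈ R0, ∀ r : ℝ, r • α ∈ R0 → r = 1 ∨ r = -1
  irred : ¬ ∃ A B : Set V, A.Nonempty ∧ B.Nonempty ∧ A ∪ B = (R0 : Set V) ∧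
      ∀ α ∈ A, ∀ β ∈ B, ⟪α, β⟫ = 0
  Rpos : Finset V
  pos_subset : Rpos ⊆ R0
  pos_partition : ∀ α ∈ R0, (α ∈ Rpos ↔ -α ∉ Rpos)
  simple : Fin n → V
  simple_mem : ∀ j, simple j ∈ Rpos
  pos_decomp : ∀ α ∈ Rpos, ∃ f : Fin n → ℕ, α = ∑ j, (f j : ℝ) • simple j
  hroot : V
  hroot_mem : hroot ∈ Rpos
  hroot_highest : ∀ β ∈ R0, ∃ f : Fin n → ℕ, hroot - β = ∑ j, (f j : ℝ) • simple j
  hs : V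
  hs_mem : hs ∈ Rpos
  hs_short : ∀ α ∈ R0, ⟪hs, hs⟫ ≤ ⟪α, α⟫
  hs_highest : ∀ β ∈ R0, ⟪β, β⟫ = ⟪hs, hs⟫ →
      ∃ f : Fin n → ℕ, hs - β = ∑ j, (f j : ℝ) • simple j
  hat : V → V
  a0 : V
  admissible : ((∀ α : V, hat α = coroot α) ∧ a0 = -hs) ∨
      ((∀ α : V, hat α = (2 / ⟪hroot, hroot⟫) • α) ∧ a0 = -hroot)
  t : V → ℝ
  t_bound : ∀ α ∈ R0, |t α| < 1
  t_invariant : ∀ α ∈ R0, ∀ β ∈ R0, t (β - ⟪β, coroot α⟫ • α) = t β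
  c : ℤ
  c_gt : 1 < c

namespace Setup

variable (S : Setup V)

/-- `m_α = 2/⟨α, α̂⟩`. -/
def m (α : V) : ℝ := 2 / ⟪α, S.hat α⟫

/-- The finite Weyl group `W₀`, generated by the reflections in the roots. -/
def W0 : Subgroup (Equiv.Perm V) :=
  Subgroup.closure {w | ∃ α ∈ S.R0, w = reflP α 0}

/-- The affine Weyl group `W`, generated by the affine reflections
`s_a` for `a = α^∨ + m_α r c`. -/
def W : Subgroup (Equiv.Perm V) :=
  Subgroup.closure {w | ∃ α ∈ S.R0, ∃ r : ℤ, w = reflP α (S.m α * (r : ℝ) * (S.c : ℝ))}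

/-- The `W₀`-orbit of a vector. -/
def orb (ω : V) : Set V := {x | ∃ w ∈ S.W0, w ω = x}

/-- The weight lattice `P` of `R₀`. -/
def Plat : Set V := {x | ∀ α ∈ S.R0, ∃ k : ℤ, ⟪x, coroot α⟫ = (k : ℝ)}

/-- The root lattice `Q` of `R₀`. -/
def Qlat : Set V := (AddSubgroup.closure (S.R0 : Set V) : Set V)

/-- The semigroup `Q⁺` generated by the positive roots. -/
def Qplus : Set V := (AddSubmonoid.closure (S.Rpos : Set V) : Set V)

/-- The cone `P⁺` of dominant weights. -/
def Pplus : Set V := {x | x ∈ S.Plat ∧ ∀ α ∈ S.Rpos, 0 ≤ ⟪x, coroot α⟫}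

/-- The dominant affine alcove `A_c = {x | 0 ≤ ⟨x,β⟩ ≤ c ∀ β ∈ R̂₀⁺}`. -/
def Alc : Set V := {x | ∀ α ∈ S.Rpos, 0 ≤ ⟪x, S.hat α⟫ ∧ ⟪x, S.hat α⟫ ≤ (S.c : ℝ)}

/-- `P_c = P ∩ A_c`. -/
def Pc : Set V := {x | x ∈ S.Plat ∧ x ∈ S.Alc}

/-- The weight lattice `P̂` of `R̂₀`. -/
def Phat : Set V := {x | ∀ α ∈ S.R0, ∃ k : ℤ, ⟪x, coroot (S.hat α)⟫ = (k : ℝ)}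

/-- `P̂_c = {μ ∈ P̂ | 0 ≤ ⟨μ,α⟩ ≤ c ∀ α ∈ R₀⁺}`. -/
def Phatc : Set V :=
  {x | x ∈ S.Phat ∧ ∀ α ∈ S.Rpos, 0 ≤ ⟪x, α⟫ ∧ ⟪x, α⟫ ≤ (S.c : ℝ)}

/-- The half sum `ρ` of the positive roots of `R₀`. -/
def rho : V := (2⁻¹ : ℝ) • ∑ α ∈ S.Rpos, α

/-- The half sum `ρ̂` of the positive roots of `R̂₀`. -/
def rhoHat : V := (2⁻¹ : ℝ) • ∑ α ∈ S.Rpos, S.hat α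

/-- The coroot lattice `Q̂^∨` of `R̂₀`. -/
def Qhatvee : Set V :=
  (AddSubgroup.closure ((fun α => coroot (S.hat α)) '' (S.R0 : Set V)) : Set V)

/-- The gradient (direction) of the affine simple root `a_j`:
`α₀` for `j = 0` and `α_j` otherwise. -/
def alpha (j : Fin (S.n + 1)) : V :=
  if h : (j : ℕ) = 0 then S.a0 else S.simple ⟨(j : ℕ) - 1, by have := j.isLt; omega⟩

/-- The constant term of the affine simple root `a_j`. -/
def kconst (j : Fin (S.n + 1)) : ℝ := if (j : ℕ) = 0 then (S.c : ℝ) else 0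

/-- The affine simple root `a_j` as an affine function on `V`. -/
def aFun (j : Fin (S.n + 1)) (x : V) : ℝ := ⟪x, coroot (S.alpha j)⟫ + S.kconst j

/-- The simple affine reflections `s_0, s_1, …, s_n`. -/
def sgen (j : Fin (S.n + 1)) : Equiv.Perm V := reflP (S.alpha j) (S.kconst j)

/-- The length of an element of the affine Weyl group: the minimal length of an
expression as a product of the simple reflections. -/
def len (w : Equiv.Perm V) : ℕ :=
  sInf {k | ∃ l : List (Fin (S.n + 1)), l.length = k ∧ (l.map S.sgen).prod = w}

/-- The length of an element of the finite Weyl group w.r.t. the simple reflections. -/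
def len0 (w : Equiv.Perm V) : ℕ :=
  sInf {k | ∃ l : List (Fin S.n), l.length = k ∧
    (l.map fun j => reflP (S.simple j) 0).prod = w}

/-- `l` is a reduced expression for `w`. -/
def IsReducedWord (l : List (Fin (S.n + 1))) (w : Equiv.Perm V) : Prop :=
  (l.map S.sgen).prod = w ∧ l.length = S.len w

/-- The Bruhat partial order on the affine Weyl group. -/
def BruhatLE (v w : Equiv.Perm V) : Prop :=
  ∃ l : List (Fin (S.n + 1)), S.IsReducedWord l w ∧
    ∃ l' : List (Fin (S.n + 1)), l'.Sublist l ∧ (l'.map S.sgen).prod = v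

/-- Evaluation of a function on the weight lattice at a point of `V` (by `0` off `P`). -/
def ev (f : ↥S.Plat → ℂ) (x : V) : ℂ := if h : x ∈ S.Plat then f ⟨x, h⟩ else 0

/-- The integral part `J_j` of the integral-reflection operators. -/
def Jop (j : Fin (S.n + 1)) (f : ↥S.Plat → ℂ) (x : ↥S.Plat) : ℂ :=
  if 0 < Int.floor (S.aFun j x.1) then
    -∑ k ∈ Finset.Icc (1 : ℤ) (Int.floor (S.aFun j x.1)),
      S.ev f (x.1 - (k : ℝ) • S.alpha j)
  else if Int.floor (S.aFun j x.1) < 0 then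
    ∑ k ∈ Finset.Icc (0 : ℤ) (-(Int.floor (S.aFun j x.1)) - 1),
      S.ev f (x.1 + (k : ℝ) • S.alpha j)
  else 0

/-- The integral-reflection operators `T_j = t_j s_j + (t_j - 1) J_j` on `𝒞(P)`. -/
def Top (j : Fin (S.n + 1)) (f : ↥S.Plat → ℂ) (x : ↥S.Plat) : ℂ :=
  (S.t (S.alpha j) : ℂ) * S.ev f ((S.sgen j)⁻¹ x.1) +
    ((S.t (S.alpha j) : ℂ) - 1) * S.Jop j f x

/-- The operator `T_{j₁} ∘ ⋯ ∘ T_{j_ℓ}` attached to a word `l = [j₁, …, j_ℓ]`. -/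
def wordOp (l : List (Fin (S.n + 1))) : (↥S.Plat → ℂ) → (↥S.Plat → ℂ) :=
  l.foldr (fun j g => S.Top j ∘ g) id

/-- `TW` realizes `w ↦ T_w` (via reduced expressions). -/
def IsTW (TW : Equiv.Perm V → (↥S.Plat → ℂ) → (↥S.Plat → ℂ)) : Prop :=
  ∀ w l, S.IsReducedWord l w → TW w = S.wordOp l

/-- `tw` realizes the length multiplicative function `w ↦ t_w` (via reduced expressions). -/
def IsTmult (tw : Equiv.Perm V → ℂ) : Prop :=
  ∀ w l, S.IsReducedWord l w → tw w = (l.map fun j => (S.t (S.alpha j) : ℂ)).prod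

/-- `wmin` realizes `x ↦ w_x`, the unique shortest affine Weyl group element moving `x`
into the dominant alcove. -/
def IsShortest (wmin : V → Equiv.Perm V) : Prop :=
  ∀ x : V, wmin x ∈ S.W ∧ wmin x x ∈ S.Alc ∧
    ∀ w ∈ S.W, w x ∈ S.Alc →
      S.len (wmin x) ≤ S.len w ∧ (S.len w = S.len (wmin x) → w = wmin x)

/-- The positive affine roots, encoded as pairs `(α, r)` representing `α^∨ + m_α r c`. -/
def RplusP : Set (V × ℤ) :=
  {p | p.1 ∈ S.R0 ∧ (1 ≤ p.2 ∨ (p.2 = 0 ∧ p.1 ∈ S.Rpos))}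

/-- The value of the affine root encoded by `p = (α, r)` at a point of `V`. -/
def affval (p : V × ℤ) (x : V) : ℝ :=
  ⟪x, coroot p.1⟫ + S.m p.1 * (p.2 : ℝ) * (S.c : ℝ)

/-- `R[λ] = {a ∈ R⁺ | a(λ) < 0}`. -/
def Raff (lam : V) : Set (V × ℤ) := {p | p ∈ S.RplusP ∧ S.affval p lam < 0}

/-- `t[λ] = ∏_{a ∈ R[λ]} t_{a'}`. -/
def tBr (lam : V) : ℂ := ∏ᶠ p ∈ S.Raff lam, (S.t p.1 : ℂ)

/-- `θ(λ) = |{a ∈ R⁺ | a(λ) = -2}|`. -/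
def thetaCt (lam : V) : ℕ :=
  Set.ncard {p : V × ℤ | p ∈ S.RplusP ∧ S.affval p lam = -2}

/-- The affine intertwining operator `𝒥`, defined via `wmin` and `TW`. -/
def JJ (wmin : V → Equiv.Perm V) (TW : Equiv.Perm V → (↥S.Plat → ℂ) → (↥S.Plat → ℂ))
    (f : ↥S.Plat → ℂ) (x : ↥S.Plat) : ℂ :=
  (S.tBr x.1)⁻¹ * S.ev (TW (wmin x.1) f) (wmin x.1 x.1)

/-- The Morse (fusion-potential) function `𝒱_μ` for a parameter family `s`. -/
def MorseOf (s : V → ℝ) (μ ξ : V) : ℝ :=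
  ((S.c : ℝ) / 2) * ⟪ξ, ξ⟫ - 2 * Real.pi * ⟪S.rhoHat + μ, ξ⟫ +
    ∑ α ∈ S.Rpos, (2 / ⟪α, coroot (S.hat α)⟫) * ∫ x in (0:ℝ)..(⟪ξ, α⟫), vintOf s α x

/-- The Morse function `𝒱_μ` for the multiplicity function of the setup. -/
def Morse (μ ξ : V) : ℝ := S.MorseOf S.t μ ξ

/-- The critical equation `cξ + ∑_{α∈R₀⁺} v_α(⟨ξ,α⟩) α̂ = 2π(ρ̂ + μ)`. -/
def CritEq (μ x : V) : Prop :=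
  (S.c : ℝ) • x + ∑ α ∈ S.Rpos, (vintOf S.t α ⟪x, α⟫) • S.hat α =
    (2 * Real.pi) • (S.rhoHat + μ)

/-- Extension of a parameter vector indexed by `R₀` to a function on `V` (by zero). -/
def extParam (s : ↥S.R0 → ℝ) : V → ℝ := fun α => if h : α ∈ S.R0 then s ⟨α, h⟩ else 0

/-- `xi` realizes `μ ↦ ξ_μ`, the unique global minimizer of `𝒱_μ`. -/
def IsMinimizer (xi : V → V) : Prop :=
  ∀ μ ∈ S.Phat, ∀ x : V, x ≠ xi μ → S.Morse μ (xi μ) < S.Morse μ x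

/-- The `c`-function of the Macdonald spherical function. -/
def Cfun (ξ : V) : ℂ :=
  ∏ α ∈ S.Rpos, (1 - (S.t α : ℂ) * Complex.exp (-(Complex.I * (⟪ξ, α⟫ : ℂ)))) /
      (1 - Complex.exp (-(Complex.I * (⟪ξ, α⟫ : ℂ))))

/-- The Macdonald spherical function `M_λ(ξ)`. -/
def Msph (lam ξ : V) : ℂ :=
  ∑ᶠ w ∈ (S.W0 : Set (Equiv.Perm V)),
    S.Cfun (w ξ) * Complex.exp (Complex.I * (⟪w ξ, lam⟫ : ℂ))

/-- The orbit sum `m_ω(e^{iξ})`. -/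
def mSym (ω ξ : V) : ℂ := ∑ᶠ ν ∈ S.orb ω, Complex.exp (Complex.I * (⟪ν, ξ⟫ : ℂ))

/-- The plane wave `e^{iξ} ∈ 𝒞(P)`. -/
def planewave (ξ : V) : ↥S.Plat → ℂ :=
  fun lam => Complex.exp (Complex.I * (⟪lam.1, ξ⟫ : ℂ))

/-- The free operator `L_{ω;1}`. -/
def Lfree (ω : V) (f : ↥S.Plat → ℂ) (x : ↥S.Plat) : ℂ :=
  ∑ᶠ ν ∈ S.orb ω, S.ev f (x.1 + ν)

/-- `φ_ξ = ∑_{v ∈ W₀} T_v e^{iξ}`. -/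
def phiW (TW : Equiv.Perm V → (↥S.Plat → ℂ) → (↥S.Plat → ℂ)) (ξ : V) : ↥S.Plat → ℂ :=
  ∑ᶠ w ∈ (S.W0 : Set (Equiv.Perm V)), TW w (S.planewave ξ)

/-- The affine Macdonald spherical function `Φ_ξ = 𝒥 φ_ξ`. -/
def PhiA (wmin : V → Equiv.Perm V)
    (TW : Equiv.Perm V → (↥S.Plat → ℂ) → (↥S.Plat → ℂ)) (ξ : V) : ↥S.Plat → ℂ :=
  S.JJ wmin TW (S.phiW TW ξ)

/-- Invariance of a lattice function under the affine Weyl group. -/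
def Winv (f : ↥S.Plat → ℂ) : Prop :=
  ∀ w ∈ S.W, ∀ x : ↥S.Plat, S.ev f (w⁻¹ x.1) = f x

/-- A minuscule dominant weight. -/
def Minuscule (ω : V) : Prop := ω ∈ S.Pplus ∧ ∀ α ∈ S.Rpos, ⟪ω, coroot α⟫ ≤ 1

/-- `P_ϑ^⋆`: the orbit of the minuscule and quasi-minuscule weights. -/
def Pstar : Set V :=
  {x | ∃ w ∈ S.W0, ∃ η : V, (S.Minuscule η ∨ η = S.hs) ∧ x = w η}

/-- `ê_t(η) = ∏_{β∈R̂₀⁺} t_β^{⟨η,β^∨⟩/2}`. -/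
def et (η : V) : ℂ :=
  ∏ α ∈ S.Rpos, (S.t α : ℂ) ^ (((⟪η, coroot (S.hat α)⟫ / 2 : ℝ) : ℂ))

/-- `ĥ_t = t_{α₀} ê_t(-α₀^∨)`. -/
def hhat : ℂ := (S.t S.a0 : ℂ) * S.et (-(coroot S.a0))

/-- `e_t(ν) = ∏_{α∈R₀⁺} t_α^{⟨ν,α^∨⟩/2}`. -/
def elit (ν : V) : ℂ :=
  ∏ α ∈ S.Rpos, (S.t α : ℂ) ^ (((⟪ν, coroot α⟫ / 2 : ℝ) : ℂ))

/-- `h_t = t_ϑ e_t(-α₀)`. -/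
def hlit : ℂ := (S.t S.hs : ℂ) * S.elit (-S.a0)

/-- The coefficients `d_{λ,ν}`. -/
def dcoef (lam ν : V) : ℂ :=
  if ν ∈ S.orb S.hs then
    (S.thetaCt (lam + ν) : ℂ) * S.elit (-ν) * S.hlit ^ zsgn ⟪lam, S.hat ν⟫
  else 0

/-- The Pieri coefficients `V_{λ,ν}(t)`. -/
def Vcoef (lam ν : V) : ℂ :=
  (∏ α ∈ S.Rpos, if ⟪lam, S.hat α⟫ = 0 ∧ 0 < ⟪ν, S.hat α⟫ then
      (1 - (S.t α : ℂ) * S.et (S.hat α)) / (1 - S.et (S.hat α)) else 1) *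
  ∏ α ∈ S.Rpos, if ⟪lam, S.hat α⟫ = (S.c : ℝ) ∧ ⟪ν, S.hat α⟫ < 0 then
      (1 - (S.t α : ℂ) * S.hhat * S.et (-(S.hat α))) / (1 - S.hhat * S.et (-(S.hat α)))
    else 1

/-- The Pieri coefficients `U_{λ,ω}(t)`. -/
def Ucoef (wmin : V → Equiv.Perm V) (lam ω : V) : ℂ :=
  (∑ᶠ ν ∈ {ν | ν ∈ S.orb ω ∧ wmin (lam + ν) (lam + ν) = lam}, S.tBr (lam + ν)) +
    (1 - (S.t S.hs : ℂ)⁻¹) *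
      ∑ᶠ ν ∈ {ν | ν ∈ S.orb ω ∧ wmin (lam + ν) lam = lam}, S.dcoef lam ν

/-- The linear part of an affine transformation of `V`. -/
def linp (w : Equiv.Perm V) (x : V) : V := w x - w (0 : V)

/-- The set `[x] = {y | y₊ = x₊, w_y ≤ w_x}`. -/
def bra (wmin : V → Equiv.Perm V) (x : V) : Set V :=
  {y | wmin y y = wmin x x ∧ S.BruhatLE (wmin y) (wmin x)}

/-- The partial order `μ ⪯ λ`. -/
def preceq (wmin : V → Equiv.Perm V) (μ lam : V) : Prop :=
  lam - μ ∈ S.Qlat ∧ convexHull ℝ (S.bra wmin μ) ⊆ convexHull ℝ (S.bra wmin lam)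

/-- The Weyl denominator `δ(ξ)`. -/
def weylDenom (ξ : V) : ℂ :=
  ∏ α ∈ S.Rpos, (Complex.exp (Complex.I * (⟪ξ, α⟫ : ℂ) / 2) -
      Complex.exp (-(Complex.I * (⟪ξ, α⟫ : ℂ) / 2)))

/-- The Weyl character `χ_λ(ξ)`. -/
def chiW (lam ξ : V) : ℂ :=
  (S.weylDenom ξ)⁻¹ * ∑ᶠ w ∈ (S.W0 : Set (Equiv.Perm V)),
    ((-1 : ℂ) ^ S.len0 w) * Complex.exp (Complex.I * (⟪w ξ, lam + S.rho⟫ : ℂ))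

/-- The counting function `N_{λ,ω}`. -/
def Ncount (lam ω : V) : ℕ :=
  Nat.card {j : Fin (S.n + 1) // S.aFun j lam = 0 ∧ S.alpha j ∈ S.orb ω}

end Setup


set_option linter.all false

lemma reflP_zero (α x : V) : reflP α 0 x = x - ⟪x, coroot α⟫ • α := by
  simp

lemma inner_coroot (x α : V) : ⟪x, coroot α⟫ = 2 / ⟪α, α⟫ * ⟪x, α⟫ := by
  rw [coroot, real_inner_smul_right]

lemma reflP_add (α x y : V) : reflP α 0 (x + y) = reflP α 0 x + reflP α 0 y := by
  simp only [reflP_zero, inner_add_left, add_smul]; abel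

lemma reflP_smul (α : V) (r : ℝ) (x : V) : reflP α 0 (r • x) = r • reflP α 0 x := by
  simp only [reflP_zero, real_inner_smul_left, smul_sub, smul_smul]

lemma reflP_inner (α x y : V) : ⟪reflP α 0 x, reflP α 0 y⟫ = ⟪x, y⟫ := by
  by_cases h : α = 0
  · simp [h]
  have hαα : ⟪α, α⟫ ≠ 0 := fun hc => h (inner_self_eq_zero.mp hc)
  simp only [reflP_zero, inner_sub_left, inner_sub_right, real_inner_smul_left,
    real_inner_smul_right, inner_coroot, real_inner_comm α y]
  field_simp
  ring

lemma reflP_mul_self (α : V) (k : ℝ) : reflP α k * reflP α k = 1 := by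
  ext x; exact refl_involutive α k x

lemma reflP_inv (α : V) (k : ℝ) : (reflP α k)⁻¹ = reflP α k :=
  inv_eq_of_mul_eq_one_left (reflP_mul_self α k)

lemma reflP_reflP (α : V) (k : ℝ) (x : V) : reflP α k (reflP α k x) = x :=
  refl_involutive α k x

lemma reflP_self (α : V) (h : α ≠ 0) : reflP α 0 α = -α := by
  have hαα : ⟪α, α⟫ ≠ 0 := fun hc => h (inner_self_eq_zero.mp hc)
  rw [reflP_zero, inner_coroot, div_mul_cancel₀ _ hαα, two_smul]; abel

lemma reflP_neg (α x : V) : reflP α 0 (-x) = - reflP α 0 x := by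
  have := reflP_smul α (-1) x
  simpa using this

lemma reflP_of_neg (α : V) : reflP (-α) 0 = reflP α 0 := by
  ext x
  simp [inner_coroot]

/-- Properties shared by all elements of the finite Weyl group. -/
structure Setup.Good (S : Setup V) (w : Equiv.Perm V) : Prop where
  add : ∀ x y, w (x + y) = w x + w y
  smul : ∀ (r : ℝ) x, w (r • x) = r • w x
  inner : ∀ x y, ⟪w x, w y⟫ = ⟪x, y⟫
  mem : ∀ α ∈ S.R0, w α ∈ S.R0
  t : ∀ α ∈ S.R0, S.t (w α) = S.t α

namespace Setup
variable {S : Setup V}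

lemma Good.mul {u v : Equiv.Perm V} (hu : S.Good u) (hv : S.Good v) : S.Good (u * v) where
  add x y := by simp [hu.add, hv.add]
  smul r x := by simp [hu.smul, hv.smul]
  inner x y := by simp [hu.inner, hv.inner]
  mem α h := hu.mem _ (hv.mem _ h)
  t α h := by simp [hu.t _ (hv.mem _ h), hv.t _ h]

lemma Good.one : S.Good 1 where
  add x y := rfl
  smul r x := rfl
  inner x y := rfl
  mem α h := h
  t α h := rfl

lemma Good.inv_mem {u : Equiv.Perm V} (hu : S.Good u) (α : V) (h : α ∈ S.R0) :
    u⁻¹ α ∈ S.R0 := by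
  have himg : S.R0.image u = S.R0 := by
    apply Finset.eq_of_subset_of_card_le
    · intro x hx
      obtain ⟨y, hy, rfl⟩ := Finset.mem_image.mp hx
      exact hu.mem y hy
    · rw [Finset.card_image_of_injective _ u.injective]
  rw [← himg] at h
  obtain ⟨y, hy, rfl⟩ := Finset.mem_image.mp h
  simpa using hy

lemma Good.inv {u : Equiv.Perm V} (hu : S.Good u) : S.Good u⁻¹ where
  add x y := by apply u.injective; simp [hu.add]
  smul r x := by apply u.injective; simp [hu.smul]
  inner x y := by rw [← hu.inner]; simp
  mem α h := hu.inv_mem α h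
  t α h := by rw [← hu.t _ (hu.inv_mem α h)]; simp

lemma Good.neg {u : Equiv.Perm V} (hu : S.Good u) (x : V) : u (-x) = - u x := by
  have := hu.smul (-1) x
  simpa using this

lemma Good.inner_left {u : Equiv.Perm V} (hu : S.Good u) (x y : V) :
    ⟪u x, y⟫ = ⟪x, u⁻¹ y⟫ := by
  rw [← hu.inner x]; simp

lemma good_refl {α : V} (h : α ∈ S.R0) : S.Good (reflP α 0) where
  add x y := reflP_add α x y
  smul r x := reflP_smul α r x
  inner x y := reflP_inner α x y
  mem β hβ := by rw [reflP_zero]; exact S.refl_mem α h β hβ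
  t β hβ := by rw [reflP_zero]; exact S.t_invariant α h β hβ

lemma good_of_mem {w : Equiv.Perm V} (hw : w ∈ S.W0) : S.Good w := by
  unfold W0 at hw
  induction hw using Subgroup.closure_induction with
  | mem x hx => obtain ⟨α, hα, rfl⟩ := hx; exact good_refl hα
  | one => exact Good.one
  | mul x y _ _ hx hy => exact hx.mul hy
  | inv x _ hx => exact hx.inv

lemma Good.coroot {u : Equiv.Perm V} (hu : S.Good u) (α : V) :
    u (coroot α) = AffinePieri.coroot (u α) := by
  unfold AffinePieri.coroot; rw [hu.smul, hu.inner]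

lemma Good.conj {u : Equiv.Perm V} (hu : S.Good u) (α : V) :
    u * reflP α 0 = reflP (u α) 0 * u := by
  ext x
  simp only [Equiv.Perm.mul_apply, reflP_zero]
  rw [sub_eq_add_neg, hu.add, hu.neg, hu.smul, ← hu.coroot, hu.inner, sub_eq_add_neg]

lemma root_ne {α : V} (h : α ∈ S.R0) : α ≠ 0 := fun hc => S.zero_not_mem (hc ▸ h)

lemma neg_mem {α : V} (h : α ∈ S.R0) : -α ∈ S.R0 := by
  have := (good_refl h).mem α h
  rwa [reflP_self α (root_ne h)] at this

lemma neg_mem_pos {α : V} (h : α ∈ S.R0) (h2 : α ∉ S.Rpos) : -α ∈ S.Rpos := by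
  by_contra hc
  exact h2 ((S.pos_partition α h).mpr hc)

lemma neg_not_mem_pos {α : V} (h : α ∈ S.Rpos) : -α ∉ S.Rpos :=
  (S.pos_partition α (S.pos_subset h)).mp h

lemma simple_R0 (j : Fin S.n) : S.simple j ∈ S.R0 := S.pos_subset (S.simple_mem j)

variable (S) in
lemma simple_span : ⊤ ≤ Submodule.span ℝ (Set.range S.simple) := by
  rw [← S.span_top, Submodule.span_le]
  have key : ∀ α ∈ S.Rpos, α ∈ Submodule.span ℝ (Set.range S.simple) := by
    intro α hα
    obtain ⟨f, hf⟩ := S.pos_decomp α hα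
    rw [hf]
    exact Submodule.sum_mem _ fun j _ => Submodule.smul_mem _ _
      (Submodule.subset_span ⟨j, rfl⟩)
  intro α hα
  by_cases h : α ∈ S.Rpos
  · exact key α h
  · have := key _ (neg_mem_pos hα h)
    simpa using Submodule.neg_mem _ this

variable (S) in
/-- The basis of simple roots. -/
def bas : Module.Basis (Fin S.n) ℝ V :=
  Module.Basis.mk (linearIndependent_of_top_le_span_of_card_eq_finrank S.simple_span
    (by simp [S.hdim])) S.simple_span

lemma bas_apply (j : Fin S.n) : S.bas j = S.simple j := by simp [bas]

variable (S) in
/-- Coordinates with respect to the simple roots. -/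
def co (j : Fin S.n) : V →ₗ[ℝ] ℝ := S.bas.coord j

lemma co_simple (i j : Fin S.n) : S.co i (S.simple j) = if j = i then 1 else 0 := by
  rw [← bas_apply]; simp [co, Finsupp.single_apply]

lemma co_sum (i : Fin S.n) (f : Fin S.n → ℝ) : S.co i (∑ j, f j • S.simple j) = f i := by
  simp [co_simple]

lemma sum_co (x : V) : ∑ j, S.co j x • S.simple j = x := by
  simp only [← bas_apply]; exact S.bas.sum_repr x

lemma co_pos_nat {α : V} (h : α ∈ S.Rpos) (i : Fin S.n) : ∃ k : ℕ, S.co i α = k := by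
  obtain ⟨f, hf⟩ := S.pos_decomp α h
  refine ⟨f i, ?_⟩
  conv_lhs => rw [hf]
  rw [co_sum]

lemma co_pos {α : V} (h : α ∈ S.Rpos) (i : Fin S.n) : 0 ≤ S.co i α := by
  obtain ⟨k, hk⟩ := co_pos_nat h i
  rw [hk]; positivity

lemma pos_of_co {α : V} (h : α ∈ S.R0) (i : Fin S.n) (hi : 0 < S.co i α) : α ∈ S.Rpos := by
  by_contra hc
  have := co_pos (neg_mem_pos h hc) i
  rw [map_neg] at this
  linarith

lemma pos_of_co' {α : V} (h : α ∈ S.R0) (hi : ∀ i, 0 ≤ S.co i α) : α ∈ S.Rpos := by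
  by_contra hc
  have h0 : α = 0 := by
    rw [← sum_co (S := S) α]
    apply Finset.sum_eq_zero
    intro i _
    have := co_pos (neg_mem_pos h hc) i
    rw [map_neg] at this
    rw [show S.co i α = 0 by linarith [hi i], zero_smul]
  exact root_ne h h0

lemma simple_refl_pos {β : V} (j : Fin S.n) (h : β ∈ S.Rpos) (hne : β ≠ S.simple j) :
    reflP (S.simple j) 0 β ∈ S.Rpos := by
  have hR := (good_refl (simple_R0 j)).mem β (S.pos_subset h)
  have hi : ∃ i, i ≠ j ∧ 0 < S.co i β := by
    by_contra hc
    push Not at hc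
    have h1 : β = S.co j β • S.simple j := by
      conv_lhs => rw [← sum_co (S := S) β]
      rw [Finset.sum_eq_single j]
      · intro i _ hij
        rw [le_antisymm (hc i hij) (co_pos h i), zero_smul]
      · simp
    have h2 := S.reduced (S.simple j) (simple_R0 j) (S.co j β)
      (by rw [← h1]; exact S.pos_subset h)
    have h3 := co_pos h j
    rcases h2 with h2 | h2
    · rw [h2, one_smul] at h1; exact hne h1
    · linarith
  obtain ⟨i, hij, hi⟩ := hi
  apply pos_of_co hR i
  rw [reflP_zero, map_sub, map_smul, co_simple, if_neg (Ne.symm hij)]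
  simpa using hi

lemma eq_simple_of {β : V} (j : Fin S.n) (h : β ∈ S.Rpos)
    (h2 : reflP (S.simple j) 0 β ∉ S.Rpos) : β = S.simple j := by
  by_contra hc; exact h2 (simple_refl_pos j h hc)

lemma simple_refl_self (j : Fin S.n) :
    reflP (S.simple j) 0 (S.simple j) = - S.simple j := reflP_self _ (root_ne (simple_R0 j))

variable (S) in
/-- Product of simple reflections along a word. -/
def wp (l : List (Fin S.n)) : Equiv.Perm V := (l.map fun j => reflP (S.simple j) 0).prod

@[simp] lemma wp_nil : S.wp [] = 1 := rfl
@[simp] lemma wp_cons (j : Fin S.n) (l : List (Fin S.n)) :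
    S.wp (j :: l) = reflP (S.simple j) 0 * S.wp l := by simp [wp]
lemma wp_append (l m : List (Fin S.n)) : S.wp (l ++ m) = S.wp l * S.wp m := by simp [wp]

lemma refl_mem_W0 {α : V} (h : α ∈ S.R0) : reflP α 0 ∈ S.W0 :=
  Subgroup.subset_closure ⟨α, h, rfl⟩

lemma wp_mem (l : List (Fin S.n)) : S.wp l ∈ S.W0 := by
  induction l with
  | nil => exact S.W0.one_mem
  | cons j l ih => rw [wp_cons]; exact S.W0.mul_mem (refl_mem_W0 (simple_R0 j)) ih

lemma wp_good (l : List (Fin S.n)) : S.Good (S.wp l) := good_of_mem (wp_mem l)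

lemma refl_word_aux (N : ℕ) : ∀ α ∈ S.Rpos, ∑ i, S.co i α ≤ N →
    ∃ l, S.wp l = reflP α 0 := by
  induction N with
  | zero =>
    intro α hα h
    exfalso
    have h0 : ∀ i ∈ Finset.univ, S.co i α = 0 := by
      rw [← Finset.sum_eq_zero_iff_of_nonneg (fun i _ => co_pos hα i)]
      apply le_antisymm (by simpa using h)
      exact Finset.sum_nonneg fun i _ => co_pos hα i
    apply root_ne (S.pos_subset hα)
    rw [← sum_co (S := S) α]
    exact Finset.sum_eq_zero fun i hi => by rw [h0 i hi, zero_smul]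
  | succ N ih =>
    intro α hα h
    by_cases hs : ∃ j, α = S.simple j
    · obtain ⟨j, rfl⟩ := hs
      exact ⟨[j], by simp⟩
    push Not at hs
    have hj : ∃ j, 0 < ⟪α, S.simple j⟫ := by
      by_contra hc
      push Not at hc
      have h1 : ⟪α, α⟫ ≤ 0 := by
        conv_lhs => rhs; rw [← sum_co (S := S) α]
        rw [inner_sum]
        apply Finset.sum_nonpos
        intro i _
        rw [real_inner_smul_right]
        exact mul_nonpos_of_nonneg_of_nonpos (co_pos hα i) (hc i)
      exact root_ne (S.pos_subset hα) (inner_self_eq_zero.mp (le_antisymm h1 real_inner_self_nonneg))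
    obtain ⟨j, hj⟩ := hj
    have hβ := simple_refl_pos j hα (hs j)
    have hjj : 0 < ⟪S.simple j, S.simple j⟫ :=
      real_inner_self_pos.mpr (root_ne (simple_R0 j))
    obtain ⟨k, hk⟩ := S.cryst (S.simple j) (simple_R0 j) α (S.pos_subset hα)
    have hk1 : (1 : ℝ) ≤ k := by
      have : (0 : ℝ) < k := by
        rw [← hk, inner_coroot]; positivity
      exact_mod_cast this
    obtain ⟨l, hl⟩ := ih _ hβ (by
      simp only [reflP_zero, map_sub, map_smul, co_simple, Finset.sum_sub_distrib, hk]
      simp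
      push_cast at h
      linarith)
    refine ⟨j :: (l ++ [j]), ?_⟩
    have hg := good_refl (S := S) (simple_R0 j)
    have := hg.conj (reflP (S.simple j) 0 α)
    rw [reflP_reflP] at this
    rw [wp_cons, wp_append, hl, ← mul_assoc, this]
    simp [mul_assoc, reflP_mul_self]

lemma refl_word {α : V} (h : α ∈ S.R0) : ∃ l, S.wp l = reflP α 0 := by
  have key : ∀ α ∈ S.Rpos, ∃ l, S.wp l = reflP α 0 := by
    intro α hα
    obtain ⟨N, hN⟩ := exists_nat_ge (∑ i, S.co i α)
    exact refl_word_aux N α hα hN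
  by_cases hp : α ∈ S.Rpos
  · exact key α hp
  · rw [← reflP_of_neg]; exact key _ (neg_mem_pos h hp)

lemma exists_word {w : Equiv.Perm V} (hw : w ∈ S.W0) : ∃ l, S.wp l = w := by
  unfold W0 at hw
  induction hw using Subgroup.closure_induction with
  | mem x hx => obtain ⟨α, hα, rfl⟩ := hx; exact refl_word hα
  | one => exact ⟨[], rfl⟩
  | mul x y _ _ hx hy =>
    obtain ⟨l, rfl⟩ := hx
    obtain ⟨m, rfl⟩ := hy
    exact ⟨l ++ m, wp_append l m⟩
  | inv x _ hx =>
    obtain ⟨l, rfl⟩ := hx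
    refine ⟨l.reverse, ?_⟩
    clear * -
    induction l with
    | nil => simp
    | cons j l ih => simp [wp_append, ih, reflP_inv]

/-- Exchange property. -/
lemma exchange (l : List (Fin S.n)) : ∀ α ∈ S.Rpos, (S.wp l)⁻¹ α ∉ S.Rpos →
    ∃ l' : List (Fin S.n), l'.length + 1 = l.length ∧ reflP α 0 * S.wp l = S.wp l' := by
  induction l with
  | nil => intro α h h2; simp at h2; exact absurd h h2
  | cons i l ih =>
    intro α h h2
    by_cases hs : reflP (S.simple i) 0 α ∈ S.Rpos
    · obtain ⟨l', h1, h3⟩ := ih _ hs (by simpa [mul_inv_rev, reflP_inv] using h2)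
      refine ⟨i :: l', by simp [h1], ?_⟩
      have := (good_refl (S := S) (simple_R0 i)).conj (reflP (S.simple i) 0 α)
      rw [reflP_reflP] at this
      rw [wp_cons, wp_cons, ← h3, ← mul_assoc, ← mul_assoc, this]
    · have := eq_simple_of i h hs
      subst this
      exact ⟨l, by simp, by rw [wp_cons, ← mul_assoc, reflP_mul_self, one_mul]⟩

variable (S) in
/-- The inversion set. -/
def InvS (w : Equiv.Perm V) : Finset V := S.Rpos.filter fun α => w⁻¹ α ∉ S.Rpos

variable (S) in
/-- The number of inversions. -/
def inv (w : Equiv.Perm V) : ℕ := (S.InvS w).card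

lemma mem_Inv {w : Equiv.Perm V} {α : V} :
    α ∈ S.InvS w ↔ α ∈ S.Rpos ∧ w⁻¹ α ∉ S.Rpos := by simp [InvS]

lemma Inv_up {w : Equiv.Perm V} (hw : w ∈ S.W0) (j : Fin S.n)
    (h : w⁻¹ (S.simple j) ∈ S.Rpos) :
    S.InvS (reflP (S.simple j) 0 * w) =
      insert (S.simple j) ((S.InvS w).image (reflP (S.simple j) 0)) := by
  have hg := (good_of_mem hw).inv
  ext α
  simp only [Finset.mem_insert, Finset.mem_image, mem_Inv, mul_inv_rev, reflP_inv,
    Equiv.Perm.mul_apply]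
  constructor
  · rintro ⟨h1, h2⟩
    by_cases hα : α = S.simple j
    · exact Or.inl hα
    · exact Or.inr ⟨_, ⟨simple_refl_pos j h1 hα, h2⟩, reflP_reflP _ _ _⟩
  · rintro (rfl | ⟨β, ⟨h1, h2⟩, rfl⟩)
    · refine ⟨S.simple_mem j, ?_⟩
      rw [simple_refl_self, hg.neg]
      exact neg_not_mem_pos h
    · refine ⟨simple_refl_pos j h1 ?_, by rwa [reflP_reflP]⟩
      rintro rfl
      exact h2 h

lemma Inv_up_notMem {w : Equiv.Perm V} (j : Fin S.n) :
    S.simple j ∉ (S.InvS w).image (reflP (S.simple j) 0) := by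
  intro h
  obtain ⟨β, hβ, h1⟩ := Finset.mem_image.mp h
  have h2 : β = - S.simple j := by
    rw [← reflP_reflP (S.simple j) 0 β, h1, simple_refl_self]
  rw [h2] at hβ
  exact neg_not_mem_pos (S.simple_mem j) (mem_Inv.mp hβ).1

lemma inv_up {w : Equiv.Perm V} (hw : w ∈ S.W0) (j : Fin S.n)
    (h : w⁻¹ (S.simple j) ∈ S.Rpos) :
    S.inv (reflP (S.simple j) 0 * w) = S.inv w + 1 := by
  rw [inv, Inv_up hw j h, Finset.card_insert_of_notMem (Inv_up_notMem j),
    Finset.card_image_of_injective _ (reflP (S.simple j) 0).injective, inv]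

lemma up_of_down {w : Equiv.Perm V} (hw : w ∈ S.W0) (j : Fin S.n)
    (h : w⁻¹ (S.simple j) ∉ S.Rpos) :
    (reflP (S.simple j) 0 * w)⁻¹ (S.simple j) ∈ S.Rpos := by
  have hg := (good_of_mem hw).inv
  rw [mul_inv_rev, reflP_inv, Equiv.Perm.mul_apply, simple_refl_self, hg.neg]
  exact neg_mem_pos (hg.mem _ (simple_R0 j)) h

lemma refl_mul_mem {w : Equiv.Perm V} (hw : w ∈ S.W0) (j : Fin S.n) :
    reflP (S.simple j) 0 * w ∈ S.W0 := S.W0.mul_mem (refl_mem_W0 (simple_R0 j)) hw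

lemma refl_refl_mul (α : V) (w : Equiv.Perm V) : reflP α 0 * (reflP α 0 * w) = w := by
  rw [← mul_assoc, reflP_mul_self, one_mul]

lemma inv_down {w : Equiv.Perm V} (hw : w ∈ S.W0) (j : Fin S.n)
    (h : w⁻¹ (S.simple j) ∉ S.Rpos) :
    S.inv w = S.inv (reflP (S.simple j) 0 * w) + 1 := by
  have := inv_up (refl_mul_mem hw j) j (up_of_down hw j h)
  rwa [refl_refl_mul] at this

lemma exists_simple_down {w : Equiv.Perm V} (hw : w ∈ S.W0) (h : S.inv w ≠ 0) :
    ∃ j, w⁻¹ (S.simple j) ∉ S.Rpos := by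
  have hg := (good_of_mem hw).inv
  by_contra hc
  push Not at hc
  apply h
  rw [inv, Finset.card_eq_zero, Finset.eq_empty_iff_forall_notMem]
  intro α hα
  rw [mem_Inv] at hα
  apply hα.2
  apply pos_of_co' (hg.mem _ (S.pos_subset hα.1))
  intro i
  let L : V →ₗ[ℝ] V := { toFun := fun x => w⁻¹ x, map_add' := hg.add, map_smul' := hg.smul }
  have : w⁻¹ α = ∑ j, S.co j α • w⁻¹ (S.simple j) := by
    change L α = ∑ j, S.co j α • L (S.simple j)
    conv_lhs => rw [← sum_co (S := S) α]
    simp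
  rw [this, map_sum]
  apply Finset.sum_nonneg
  intro j _
  rw [map_smul]
  exact mul_nonneg (co_pos hα.1 j) (co_pos (hc j) i)

lemma exists_simple_up {w : Equiv.Perm V} (hw : w ∈ S.W0) (h : S.inv w < S.Rpos.card) :
    ∃ j, w⁻¹ (S.simple j) ∈ S.Rpos := by
  have hg := (good_of_mem hw).inv
  by_contra hc
  push Not at hc
  apply h.ne
  rw [inv]
  congr 1
  apply Finset.filter_true_of_mem
  intro α hα hα2
  apply neg_not_mem_pos hα2
  apply pos_of_co' (neg_mem (hg.mem _ (S.pos_subset hα)))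
  intro i
  let L : V →ₗ[ℝ] V := { toFun := fun x => w⁻¹ x, map_add' := hg.add, map_smul' := hg.smul }
  have : -(w⁻¹ α) = ∑ j, S.co j α • (-(w⁻¹ (S.simple j))) := by
    change -(L α) = ∑ j, S.co j α • (-L (S.simple j))
    conv_lhs => rw [← sum_co (S := S) α]
    simp
  rw [this, map_sum]
  apply Finset.sum_nonneg
  intro j _
  rw [map_smul]
  exact mul_nonneg (co_pos hα j)
    (co_pos (neg_mem_pos (hg.mem _ (simple_R0 j)) (hc j)) i)

lemma inv_le (w : Equiv.Perm V) : S.inv w ≤ S.Rpos.card :=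
  Finset.card_le_card (Finset.filter_subset _ _)

variable (S) in
lemma exists_longest_aux (k : ℕ) : k ≤ S.Rpos.card → ∃ w ∈ S.W0, k ≤ S.inv w := by
  induction k with
  | zero => intro _; exact ⟨1, S.W0.one_mem, Nat.zero_le _⟩
  | succ k ih =>
    intro hk
    obtain ⟨w, hw, h1⟩ := ih (by omega)
    by_cases h2 : S.inv w < S.Rpos.card
    · obtain ⟨j, hj⟩ := exists_simple_up hw h2
      exact ⟨_, refl_mul_mem hw j, by rw [inv_up hw j hj]; omega⟩
    · exact ⟨w, hw, by omega⟩

variable (S) in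
lemma exists_longest : ∃ w ∈ S.W0, S.InvS w = S.Rpos := by
  obtain ⟨w, hw, h⟩ := S.exists_longest_aux _ le_rfl
  exact ⟨w, hw, Finset.eq_of_subset_of_card_le (Finset.filter_subset _ _) h⟩

lemma exists_reduced_aux (k : ℕ) : ∀ l : List (Fin S.n), l.length ≤ k →
    ∃ l', S.wp l' = S.wp l ∧ l'.length = S.inv (S.wp l) := by
  induction k with
  | zero =>
    intro l hl
    have : l = [] := List.eq_nil_of_length_eq_zero (by omega)
    subst this
    refine ⟨[], rfl, ?_⟩
    symm
    simp [inv, InvS]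
  | succ k ih =>
    intro l hl
    by_cases h0 : S.inv (S.wp l) = 0
    · cases l with
      | nil => exact ⟨[], rfl, by rw [h0]; rfl⟩
      | cons i l =>
        have h1 : (S.wp l)⁻¹ (S.simple i) ∉ S.Rpos := by
          intro hc
          rw [wp_cons, inv_up (wp_mem l) i hc] at h0
          omega
        obtain ⟨l', h2, h3⟩ := exchange l _ (S.simple_mem i) h1
        obtain ⟨m, h4, h5⟩ := ih l' (by simp at hl; omega)
        exact ⟨m, by rw [h4, ← h3, wp_cons], by rw [h5, ← h3, wp_cons]⟩
    · obtain ⟨j, hj⟩ := exists_simple_down (wp_mem l) h0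
      obtain ⟨l', h2, h3⟩ := exchange l _ (S.simple_mem j) hj
      obtain ⟨m, h4, h5⟩ := ih l' (by omega)
      refine ⟨j :: m, ?_, ?_⟩
      · rw [wp_cons, h4, ← h3, refl_refl_mul]
      · rw [List.length_cons, h5, ← h3, ← inv_down (wp_mem l) j hj]

lemma exists_reduced {w : Equiv.Perm V} (hw : w ∈ S.W0) :
    ∃ l, S.wp l = w ∧ l.length = S.inv w := by
  obtain ⟨l, rfl⟩ := exists_word hw
  exact exists_reduced_aux _ l le_rfl

variable (S) in
lemma W0_finite : (S.W0 : Set (Equiv.Perm V)).Finite := by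
  apply Set.Finite.subset ((List.finite_length_le (Fin S.n) S.Rpos.card).image S.wp)
  intro w hw
  obtain ⟨l, h1, h2⟩ := exists_reduced hw
  exact ⟨l, by simpa [h2] using inv_le w, h1⟩

end Setup

namespace Setup
variable {S : Setup V}

lemma hat_pos {α : V} (h : α ≠ 0) : ∃ κ : ℝ, 0 < κ ∧ S.hat α = κ • α := by
  have h1 : 0 < ⟪α, α⟫ := real_inner_self_pos.mpr h
  rcases S.admissible with ⟨h2, _⟩ | ⟨h2, _⟩
  · exact ⟨2 / ⟪α, α⟫, by positivity, by rw [h2, coroot]⟩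
  · have h3 : 0 < ⟪S.hroot, S.hroot⟫ :=
      real_inner_self_pos.mpr (root_ne (S.pos_subset S.hroot_mem))
    exact ⟨2 / ⟪S.hroot, S.hroot⟫, by positivity, h2 α⟩

lemma Good.hat {u : Equiv.Perm V} (hu : S.Good u) (α : V) : u (S.hat α) = S.hat (u α) := by
  rcases S.admissible with ⟨h2, _⟩ | ⟨h2, _⟩
  · rw [h2, h2, hu.coroot]
  · rw [h2, h2, hu.smul]

lemma coroot_coroot (α : V) : coroot (coroot α) = α := by
  by_cases h : α = 0
  · simp [h, coroot]
  have h1 : ⟪α, α⟫ ≠ 0 := fun hc => h (inner_self_eq_zero.mp hc)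
  simp only [coroot, real_inner_smul_left, real_inner_smul_right, smul_smul]
  have : 2 / (2 / ⟪α, α⟫ * (2 / ⟪α, α⟫ * ⟪α, α⟫)) * (2 / ⟪α, α⟫) = 1 := by field_simp
  rw [this, one_smul]

lemma hat_inj {α β : V} (h : S.hat α = S.hat β) : α = β := by
  rcases S.admissible with ⟨h2, _⟩ | ⟨h2, _⟩
  · rw [h2, h2] at h
    rw [← coroot_coroot α, h, coroot_coroot]
  · have h3 : ⟪S.hroot, S.hroot⟫ ≠ 0 := fun hc =>
      root_ne (S.pos_subset S.hroot_mem) (inner_self_eq_zero.mp hc)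
    rw [h2, h2] at h
    exact smul_right_injective V (div_ne_zero two_ne_zero h3) h

lemma hat_neg (α : V) : S.hat (-α) = - S.hat α := by
  rcases S.admissible with ⟨h2, _⟩ | ⟨h2, _⟩
  · rw [h2, h2]; simp [coroot]
  · rw [h2, h2]; simp

lemma dom_of_high {θ : V} (h : ∀ j, ∃ f : Fin S.n → ℕ,
      θ - reflP (S.simple j) 0 θ = ∑ i, (f i : ℝ) • S.simple i) (α : V) (hα : α ∈ S.Rpos) :
    0 ≤ ⟪θ, α⟫ := by
  rw [← sum_co (S := S) α, inner_sum]
  apply Finset.sum_nonneg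
  intro j _
  rw [real_inner_smul_right]
  apply mul_nonneg (co_pos hα j)
  obtain ⟨f, hf⟩ := h j
  have h1 := congrArg (S.co j) hf
  rw [co_sum, reflP_zero, sub_sub_cancel, map_smul, co_simple, if_pos rfl, inner_coroot] at h1
  have hjj : 0 < ⟪S.simple j, S.simple j⟫ :=
    real_inner_self_pos.mpr (root_ne (simple_R0 j))
  by_contra hc
  push Not at hc
  have h2 : (2 / ⟪S.simple j, S.simple j⟫ * ⟪θ, S.simple j⟫) • (1 : ℝ) < 0 := by
    rw [smul_eq_mul, mul_one]
    exact mul_neg_of_pos_of_neg (by positivity) hc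
  rw [h1] at h2
  have : (0 : ℝ) ≤ f j := by positivity
  linarith

variable (S) in
/-- Properties of `θ = -α₀` used for the length bound. -/
lemma theta_pack : -S.a0 ∈ S.Rpos ∧ (∀ α ∈ S.Rpos, 0 ≤ ⟪-S.a0, S.hat α⟫) ∧
    (∀ β ∈ S.R0, ∃ k : ℤ, ⟪-S.a0, S.hat β⟫ = k) ∧
    (∀ β ∈ S.R0, 2 ≤ ⟪-S.a0, S.hat β⟫ → β = -S.a0) ∧ ⟪-S.a0, S.hat (-S.a0)⟫ = 2 := by
  suffices h : -S.a0 ∈ S.Rpos ∧ (∀ α ∈ S.Rpos, 0 ≤ ⟪-S.a0, α⟫) ∧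
    (∀ β ∈ S.R0, ∃ k : ℤ, ⟪-S.a0, S.hat β⟫ = k) ∧
    (∀ β ∈ S.R0, 2 ≤ ⟪-S.a0, S.hat β⟫ → β = -S.a0) ∧ ⟪-S.a0, S.hat (-S.a0)⟫ = 2 by
    refine ⟨h.1, ?_, h.2.2⟩
    intro α hα
    obtain ⟨κ, h1, h2⟩ := hat_pos (S := S) (root_ne (S.pos_subset hα))
    rw [h2, real_inner_smul_right]
    exact mul_nonneg h1.le (h.2.1 α hα)
  rcases S.admissible with ⟨h2, h3⟩ | ⟨h2, h3⟩
  · rw [h3, neg_neg]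
    have hR := S.pos_subset S.hs_mem
    refine ⟨S.hs_mem, dom_of_high ?_, ?_, ?_, ?_⟩
    · intro j
      apply S.hs_highest
      · exact (good_refl (simple_R0 j)).mem _ hR
      · rw [reflP_inner]
    · intro β hβ
      rw [h2]
      exact S.cryst β hβ _ hR
    · intro β hβ hk
      have hββ : 0 < ⟪β, β⟫ := real_inner_self_pos.mpr (root_ne hβ)
      rw [h2, inner_coroot] at hk
      have h4 : ⟪β, β⟫ ≤ ⟪S.hs, β⟫ := by
        have := mul_le_mul_of_nonneg_right hk hββ.le
        field_simp at this
        linarith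
      have h5 := S.hs_short β hβ
      have h6 : ⟪β - S.hs, β - S.hs⟫ ≤ 0 := by
        rw [real_inner_sub_sub_self, real_inner_comm S.hs β]
        linarith
      exact sub_eq_zero.mp (inner_self_eq_zero.mp (le_antisymm h6 real_inner_self_nonneg))
    · have hββ : ⟪S.hs, S.hs⟫ ≠ 0 := fun hc => root_ne hR (inner_self_eq_zero.mp hc)
      rw [h2, inner_coroot, div_mul_cancel₀ _ hββ]
  · rw [h3, neg_neg]
    have hR := S.pos_subset S.hroot_mem
    have hββ : 0 < ⟪S.hroot, S.hroot⟫ := real_inner_self_pos.mpr (root_ne hR)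
    have hdom : ∀ α ∈ S.Rpos, 0 ≤ ⟪S.hroot, α⟫ := by
      apply dom_of_high
      intro j
      apply S.hroot_highest
      exact (good_refl (simple_R0 j)).mem _ hR
    have hsw : ∀ β, ⟪S.hroot, S.hat β⟫ = ⟪β, coroot S.hroot⟫ := by
      intro β
      rw [h2, inner_coroot, real_inner_smul_right, real_inner_comm β]
    refine ⟨S.hroot_mem, hdom, ?_, ?_, ?_⟩
    · intro β hβ
      rw [hsw]
      exact S.cryst _ hR _ hβ
    · intro β hβ hk
      obtain ⟨f, hf⟩ := S.hroot_highest β hβ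
      have h4 : 0 ≤ ⟪S.hroot, S.hroot - β⟫ := by
        rw [hf, inner_sum]
        apply Finset.sum_nonneg
        intro j _
        rw [real_inner_smul_right]
        exact mul_nonneg (by positivity) (hdom _ (S.simple_mem j))
      rw [inner_sub_right] at h4
      rw [hsw] at hk
      have hk2 : ⟪β, coroot S.hroot⟫ = 2 := by
        apply le_antisymm _ hk
        rw [inner_coroot, div_mul_eq_mul_div, div_le_iff₀ hββ, real_inner_comm]
        linarith
      have h5 := neg_mem ((good_refl hR).mem β hβ)
      rw [reflP_zero, hk2] at h5
      obtain ⟨g, hg⟩ := S.hroot_highest _ h5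
      have h6 : ∀ i, S.co i (S.hroot - β) = 0 := by
        intro i
        have e1 : S.co i (S.hroot - β) = f i := by rw [hf, co_sum]
        have e2 : S.co i (S.hroot - -(β - (2 : ℝ) • S.hroot)) = g i := by rw [hg, co_sum]
        have e3 : (0 : ℝ) ≤ f i := by positivity
        have e4 : (0 : ℝ) ≤ g i := by positivity
        simp only [map_sub, map_neg, map_smul, smul_eq_mul] at e1 e2 ⊢
        linarith
      have h7 : S.hroot - β = 0 := by
        rw [← sum_co (S := S) (S.hroot - β)]
        exact Finset.sum_eq_zero fun i _ => by rw [h6, zero_smul]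
      exact (sub_eq_zero.mp h7).symm
    · rw [hsw, inner_coroot, div_mul_cancel₀ _ hββ.ne']

@[simp] lemma alpha_zero : S.alpha 0 = S.a0 := by simp [alpha]
@[simp] lemma alpha_succ (j : Fin S.n) : S.alpha j.succ = S.simple j := by simp [alpha]
@[simp] lemma kconst_zero : S.kconst 0 = S.c := by simp [kconst]
@[simp] lemma kconst_succ (j : Fin S.n) : S.kconst j.succ = 0 := by simp [kconst]
@[simp] lemma sgen_succ (j : Fin S.n) : S.sgen j.succ = reflP (S.simple j) 0 := by
  simp [sgen]

variable (S) in
/-- Positive affine roots (rescaled) as functions. -/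
def IsPos (f : V → ℝ) : Prop := ∃ β ∈ S.R0, ∃ r : ℤ,
  (∀ x, f x = ⟪x, S.hat β⟫ + r * S.c) ∧ (0 < r ∨ r = 0 ∧ β ∈ S.Rpos)

variable (S) in
/-- Rescaled simple affine roots. -/
def na (j : Fin (S.n + 1)) (x : V) : ℝ := ⟪x, S.hat (S.alpha j)⟫ + S.kconst j

lemma isPos_step (f : V → ℝ) (hf : S.IsPos f) (j : Fin (S.n + 1))
    (h2 : ¬ S.IsPos (f ∘ S.sgen j)) : f = S.na j := by
  obtain ⟨β, hβ, r, hfx, hr⟩ := hf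
  induction j using Fin.cases with
  | succ j =>
    rw [sgen_succ] at h2
    have hg := good_refl (S := S) (simple_R0 j)
    have hcomp : ∀ x, (f ∘ reflP (S.simple j) 0) x =
        ⟪x, S.hat (reflP (S.simple j) 0 β)⟫ + r * S.c := by
      intro x
      rw [Function.comp, hfx, hg.inner_left, reflP_inv, hg.hat]
    have h3 : ¬ (0 < r ∨ r = 0 ∧ reflP (S.simple j) 0 β ∈ S.Rpos) := fun hc =>
      h2 ⟨_, hg.mem β hβ, r, hcomp, hc⟩
    push Not at h3
    have hr0 : r = 0 ∧ β ∈ S.Rpos := by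
      rcases hr with hr | hr
      · omega
      · exact hr
    have := eq_simple_of j hr0.2 (h3.2 hr0.1)
    ext x
    rw [hfx, na, this, hr0.1]
    simp
  | zero =>
    obtain ⟨t1, t2, t3, t4, t5⟩ := S.theta_pack
    obtain ⟨θ, hθ⟩ : ∃ θ, θ = -S.a0 := ⟨_, rfl⟩
    rw [← hθ] at t1 t2 t3 t4 t5
    have ha0 : S.a0 = -θ := by rw [hθ, neg_neg]
    have hθR := S.pos_subset t1
    have hg := good_refl (S := S) hθR
    obtain ⟨p, hp⟩ := t3 β hβ
    have hsg : ∀ x, S.sgen 0 x = reflP θ 0 x + (S.c : ℝ) • θ := by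
      intro x
      simp only [sgen, alpha_zero, kconst_zero, reflP_apply, ha0, inner_coroot]
      simp only [inner_neg_neg, inner_neg_right, add_smul, smul_neg, mul_neg, neg_smul]
      simp
      abel
    have hβ' := hg.mem β hβ
    have hp' : ⟪θ, S.hat (reflP θ 0 β)⟫ = -p := by
      rw [← hg.hat, ← hp, ← hg.inner θ, reflP_reflP, reflP_self θ (root_ne hθR),
        inner_neg_left]
    have hcomp : ∀ x, (f ∘ S.sgen 0) x =
        ⟪x, S.hat (reflP θ 0 β)⟫ + ((r + p : ℤ) : ℝ) * S.c := by
      intro x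
      rw [Function.comp, hfx, hsg, inner_add_left, hg.inner_left, reflP_inv, hg.hat,
        real_inner_smul_left, hp]
      push_cast
      ring
    have h3 : ¬ (0 < r + p ∨ r + p = 0 ∧ reflP θ 0 β ∈ S.Rpos) := fun hc =>
      h2 ⟨_, hβ', r + p, hcomp, hc⟩
    push Not at h3
    obtain ⟨h3, h4⟩ := h3
    rcases hr with hr | ⟨hr, hβp⟩
    · rcases h3.lt_or_eq with h5 | h5
      · have h6 : -β = θ := by
          apply t4 _ (neg_mem hβ)
          rw [hat_neg, inner_neg_right, hp]
          have : (2 : ℤ) ≤ -p := by omega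
          exact_mod_cast this
        have h7 : p = -2 := by
          have h8 : β = -θ := by rw [← h6, neg_neg]
          rw [h8, hat_neg, inner_neg_right, t5] at hp
          have : ((-2 : ℤ) : ℝ) = p := by push_cast; exact hp
          exact_mod_cast this.symm
        have h8 : r = 1 := by omega
        ext x
        rw [hfx, na, h8, alpha_zero, kconst_zero, ha0, ← h6]
        simp
      · exfalso
        have h6 := neg_mem_pos hβ' (h4 h5)
        have h7 := t2 _ h6
        rw [hat_neg, inner_neg_right, hp', neg_neg] at h7
        have : 0 ≤ p := by exact_mod_cast h7
        omega
    · exfalso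
      have h7 := t2 _ hβp
      rw [hp] at h7
      have h8 : 0 ≤ p := by exact_mod_cast h7
      have h9 : p = 0 := by omega
      have h10 : reflP θ 0 β = β := by
        obtain ⟨κ, k1, k2⟩ := hat_pos (S := S) (root_ne hβ)
        rw [k2, real_inner_smul_right, h9] at hp
        have : ⟪θ, β⟫ = 0 := by simpa [k1.ne'] using hp
        rw [reflP_zero, inner_coroot, real_inner_comm θ β, this]
        simp
      exact h4 (by omega) (by rw [h10]; exact hβp)

lemma affine_bound (l : List (Fin (S.n + 1))) :
    {f : V → ℝ | S.IsPos f ∧ ¬ S.IsPos (f ∘ (l.map S.sgen).prod)}.encard ≤ l.length := by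
  induction l using List.reverseRecOn with
  | nil =>
    have : {f : V → ℝ | S.IsPos f ∧ ¬ S.IsPos (f ∘ (([] : List (Fin (S.n + 1))).map S.sgen).prod)}
        = ∅ := by
      ext f
      simp
    rw [this]; simp
  | append_singleton l j ih =>
    have hsub : {f : V → ℝ | S.IsPos f ∧ ¬ S.IsPos (f ∘ ((l ++ [j]).map S.sgen).prod)} ⊆
        insert (fun x => S.na j (((l.map S.sgen).prod)⁻¹ x))
          {f : V → ℝ | S.IsPos f ∧ ¬ S.IsPos (f ∘ (l.map S.sgen).prod)} := by
      rintro f ⟨h1, h2⟩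
      by_cases h3 : S.IsPos (f ∘ (l.map S.sgen).prod)
      · left
        have := isPos_step _ h3 j (by
          simpa [Function.comp_assoc, Equiv.Perm.coe_mul] using h2)
        rw [← this]
        ext x
        simp
      · right; exact ⟨h1, h3⟩
    refine (Set.encard_le_encard hsub).trans ((Set.encard_insert_le _ _).trans ?_)
    simp only [List.length_append, List.length_singleton, Nat.cast_add, Nat.cast_one]
    gcongr

lemma inv_le_length {w : Equiv.Perm V} (hw : w ∈ S.W0) (l : List (Fin (S.n + 1)))
    (hl : (l.map S.sgen).prod = w) : S.inv w ≤ l.length := by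
  have hg := good_of_mem hw
  have h1 := affine_bound l
  rw [hl] at h1
  have hc : (S.c : ℝ) ≠ 0 := by
    have := S.c_gt
    exact_mod_cast (by omega : S.c ≠ 0)
  let F : V → V → ℝ := fun α x => ⟪x, S.hat α⟫
  have hF : Function.Injective F := by
    intro α β h
    apply hat_inj (S := S)
    apply ext_inner_left ℝ
    intro x
    exact congrFun h x
  have hsub : F '' (S.InvS w : Set V) ⊆ {f : V → ℝ | S.IsPos f ∧ ¬ S.IsPos (f ∘ w)} := by
    rintro _ ⟨α, hα, rfl⟩
    have hα' := mem_Inv.mp hα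
    refine ⟨⟨α, S.pos_subset hα'.1, 0, by simp [F], Or.inr ⟨rfl, hα'.1⟩⟩, ?_⟩
    rintro ⟨β, hβ, r, h2, h3⟩
    have h4 : ∀ x, ⟪x, S.hat (w⁻¹ α)⟫ = ⟪x, S.hat β⟫ + r * S.c := by
      intro x
      rw [← h2, Function.comp]
      change _ = ⟪w x, S.hat α⟫
      rw [hg.inner_left, hg.inv.hat]
    have h5 : r = 0 := by
      have := h4 0
      simpa [hc] using this
    rw [h5] at h4 h3
    have h6 : w⁻¹ α = β := by
      apply hat_inj (S := S)
      apply ext_inner_left ℝ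
      intro x
      simpa using h4 x
    apply hα'.2
    rw [h6]
    simpa using h3
  have h2 := (Set.encard_le_encard hsub).trans h1
  rw [hF.encard_image, Set.encard_coe_eq_coe_finsetCard] at h2
  exact_mod_cast h2

lemma prod_succ (l : List (Fin S.n)) : ((l.map Fin.succ).map S.sgen).prod = S.wp l := by
  induction l with
  | nil => rfl
  | cons j l ih => simp only [List.map_cons, List.prod_cons, ih, wp_cons, sgen_succ]

lemma isReduced_succ {w : Equiv.Perm V} {l : List (Fin S.n)} (h1 : S.wp l = w)
    (h2 : l.length = S.inv w) : S.IsReducedWord (l.map Fin.succ) w := by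
  have hw : w ∈ S.W0 := h1 ▸ wp_mem l
  refine ⟨by rw [prod_succ, h1], ?_⟩
  unfold len
  apply le_antisymm
  · apply le_csInf
    · exact ⟨_, l.map Fin.succ, rfl, by rw [prod_succ, h1]⟩
    · rintro k ⟨m, rfl, hm⟩
      rw [List.length_map, h2]
      exact inv_le_length hw m hm
  · apply Nat.sInf_le
    exact ⟨l.map Fin.succ, rfl, by rw [prod_succ, h1]⟩

end Setup

namespace Setup
variable {S : Setup V}

lemma plat_shift {x α : V} (hx : x ∈ S.Plat) (hα : α ∈ S.R0) (k : ℤ) :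
    x + (k : ℝ) • α ∈ S.Plat := by
  intro β hβ
  obtain ⟨m, hm⟩ := hx β hβ
  obtain ⟨n, hn⟩ := S.cryst β hβ α hα
  refine ⟨m + k * n, ?_⟩
  rw [inner_add_left, real_inner_smul_left, hm, hn]
  push_cast
  ring

lemma plat_shift' {x α : V} (hx : x ∈ S.Plat) (hα : α ∈ S.R0) (k : ℤ) :
    x - (k : ℝ) • α ∈ S.Plat := by
  have := plat_shift hx hα (-k)
  rw [Int.cast_neg, neg_smul, ← sub_eq_add_neg] at this
  exact this

lemma ev_mem (f : ↥S.Plat → ℂ) {x : V} (hx : x ∈ S.Plat) : S.ev f x = f ⟨x, hx⟩ := by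
  simp [ev, hx]

lemma ev_add (f g : ↥S.Plat → ℂ) (x : V) : S.ev (f + g) x = S.ev f x + S.ev g x := by
  unfold ev; split_ifs <;> simp

lemma ev_smul (a : ℂ) (f : ↥S.Plat → ℂ) (x : V) : S.ev (a • f) x = a * S.ev f x := by
  unfold ev; split_ifs <;> simp

variable (S) in
/-- `Top` as a linear map. -/
def TopL (j : Fin (S.n + 1)) : (↥S.Plat → ℂ) →ₗ[ℂ] (↥S.Plat → ℂ) where
  toFun := S.Top j
  map_add' f g := by
    ext x
    simp only [Top, Jop, ev_add, Pi.add_apply, Finset.sum_add_distrib]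
    split_ifs <;> ring
  map_smul' a f := by
    ext x
    simp only [Top, Jop, ev_smul, Pi.smul_apply, ← Finset.mul_sum, smul_eq_mul, RingHom.id_apply]
    split_ifs <;> ring

lemma TopL_apply (j : Fin (S.n + 1)) (f : ↥S.Plat → ℂ) : S.TopL j f = S.Top j f := rfl

/-- The exponential `e^{-i⟨μ,α⟩}`. -/
def qq (μ α : V) : ℂ := Complex.exp (-(Complex.I * (⟪μ, α⟫ : ℂ)))

lemma qq_ne (μ α : V) : qq μ α ≠ 0 := Complex.exp_ne_zero _

lemma qq_norm (μ α : V) : ‖qq μ α‖ = 1 := by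
  unfold qq
  rw [← mul_neg, ← Complex.ofReal_neg, mul_comm]
  exact Complex.norm_exp_ofReal_mul_I _

lemma qq_neg (μ α : V) : qq μ (-α) = (qq μ α)⁻¹ := by
  unfold qq
  rw [← Complex.exp_neg, inner_neg_right]
  simp

lemma qq_good {w : Equiv.Perm V} (hw : S.Good w) (μ α : V) : qq (w μ) (w α) = qq μ α := by
  unfold qq; rw [hw.inner]

lemma qq_eq_one (μ α : V) : qq μ α = 1 ↔ ∃ k : ℤ, ⟪μ, α⟫ = 2 * Real.pi * (k : ℝ) := by
  unfold qq
  rw [Complex.exp_eq_one_iff]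
  constructor
  · rintro ⟨n, hn⟩
    refine ⟨-n, ?_⟩
    have h := congrArg Complex.im hn
    simp at h
    push_cast
    linarith
  · rintro ⟨k, hk⟩
    refine ⟨-k, ?_⟩
    rw [hk]
    push_cast
    ring

variable (S) in
/-- The rank one `c`-function. -/
def cc (α μ : V) : ℂ := (1 - (S.t α : ℂ) * qq μ α) / (1 - qq μ α)

lemma Cfun_eq (μ : V) : S.Cfun μ = ∏ α ∈ S.Rpos, S.cc α μ := rfl

lemma cc_good {w : Equiv.Perm V} (hw : S.Good w) {α : V} (hα : α ∈ S.R0) (μ : V) :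
    S.cc (w α) (w μ) = S.cc α μ := by
  unfold cc; rw [qq_good hw, hw.t α hα]

variable (S) in
/-- Diagonal coefficient. -/
def Ac (j : Fin S.n) (μ : V) : ℂ :=
  (1 - (S.t (S.simple j) : ℂ)) * qq μ (S.simple j) / (1 - qq μ (S.simple j))

variable (S) in
/-- Off-diagonal coefficient. -/
def Bc (j : Fin S.n) (μ : V) : ℂ :=
  ((S.t (S.simple j) : ℂ) - qq μ (S.simple j)) / (1 - qq μ (S.simple j))

lemma qq_refl (j : Fin S.n) (μ : V) :
    qq (reflP (S.simple j) 0 μ) (S.simple j) = (qq μ (S.simple j))⁻¹ := by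
  rw [← qq_neg, ← simple_refl_self, ← qq_good (good_refl (simple_R0 j)), reflP_reflP]

lemma Bc_eq_cc (j : Fin S.n) (μ : V) (h : qq μ (S.simple j) ≠ 1) :
    S.Bc j μ = S.cc (S.simple j) (reflP (S.simple j) 0 μ) := by
  unfold Bc cc
  rw [qq_refl]
  have h0 := qq_ne μ (S.simple j)
  have h1 : 1 - qq μ (S.simple j) ≠ 0 := sub_ne_zero.mpr h.symm
  have h2 : qq μ (S.simple j) - 1 ≠ 0 := sub_ne_zero.mpr h
  have e1 : 1 - (S.t (S.simple j) : ℂ) * (qq μ (S.simple j))⁻¹ =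
    (qq μ (S.simple j) - S.t (S.simple j)) / qq μ (S.simple j) := by field_simp
  have e2 : 1 - (qq μ (S.simple j))⁻¹ = (qq μ (S.simple j) - 1) / qq μ (S.simple j) := by
    field_simp
  rw [e1, e2, div_div_div_cancel_right₀ h0, div_eq_div_iff h1 h2]
  ring

lemma Ac_add (j : Fin S.n) (μ : V) (h : qq μ (S.simple j) ≠ 1) :
    S.Ac j μ + S.Bc j μ = S.t (S.simple j) := by
  unfold Ac Bc
  have h1 : 1 - qq μ (S.simple j) ≠ 0 := sub_ne_zero.mpr h.symm
  field_simp
  ring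

lemma Ac_refl (j : Fin S.n) (μ : V) (h : qq μ (S.simple j) ≠ 1) :
    S.Ac j μ + S.Ac j (reflP (S.simple j) 0 μ) = S.t (S.simple j) - 1 := by
  unfold Ac
  rw [qq_refl]
  have h0 := qq_ne μ (S.simple j)
  have h1 : 1 - qq μ (S.simple j) ≠ 0 := sub_ne_zero.mpr h.symm
  have h2 : qq μ (S.simple j) - 1 ≠ 0 := sub_ne_zero.mpr h
  have e2 : 1 - (qq μ (S.simple j))⁻¹ = (qq μ (S.simple j) - 1) / qq μ (S.simple j) := by
    field_simp
  rw [e2, ← div_eq_mul_inv, div_div_div_cancel_right₀ h0]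
  have e3 : qq μ (S.simple j) - 1 = -(1 - qq μ (S.simple j)) := by ring
  rw [e3, div_neg]
  field_simp
  ring

lemma Bc_ne (j : Fin S.n) (μ : V) (h : qq μ (S.simple j) ≠ 1) : S.Bc j μ ≠ 0 := by
  unfold Bc
  have h1 : 1 - qq μ (S.simple j) ≠ 0 := sub_ne_zero.mpr h.symm
  refine div_ne_zero ?_ h1
  rw [sub_ne_zero]
  intro hc
  have h2 := congrArg norm hc
  rw [qq_norm, Complex.norm_real, Real.norm_eq_abs] at h2
  have := S.t_bound _ (simple_R0 j)
  linarith

lemma geom1 (q : ℂ) (h : q ≠ 1) (n : ℕ) :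
    ∑ k ∈ Finset.Icc (1 : ℤ) n, q ^ k = q * (1 - q ^ n) / (1 - q) := by
  have h1 : 1 - q ≠ 0 := sub_ne_zero.mpr h.symm
  induction n with
  | zero => simp
  | succ n ih =>
    have : Finset.Icc (1 : ℤ) ((n + 1 : ℕ) : ℤ) =
        insert ((n + 1 : ℕ) : ℤ) (Finset.Icc (1 : ℤ) n) := by
      ext k; simp; omega
    rw [this, Finset.sum_insert (by simp), ih, zpow_natCast]
    field_simp
    ring

lemma geom0 (q : ℂ) (h : q ≠ 1) (n : ℕ) :
    ∑ k ∈ Finset.Icc (0 : ℤ) (n - 1), q ^ k = (1 - q ^ n) / (1 - q) := by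
  have h1 : 1 - q ≠ 0 := sub_ne_zero.mpr h.symm
  induction n with
  | zero => simp
  | succ n ih =>
    have : Finset.Icc (0 : ℤ) (((n + 1 : ℕ) : ℤ) - 1) =
        insert (n : ℤ) (Finset.Icc (0 : ℤ) (n - 1)) := by
      ext k; simp; omega
    rw [this, Finset.sum_insert (by simp), ih, zpow_natCast]
    field_simp
    ring

lemma ev_shift (μ : V) (x : ↥S.Plat) {α : V} (hα : α ∈ S.R0) (k : ℤ) :
    S.ev (S.planewave μ) (x.1 - (k : ℝ) • α) = S.planewave μ x * qq μ α ^ k := by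
  rw [ev_mem _ (plat_shift' x.2 hα k)]
  unfold planewave qq
  rw [← Complex.exp_int_mul, ← Complex.exp_add]
  congr 1
  simp only [inner_sub_left, real_inner_smul_left]
  rw [real_inner_comm μ α]
  push_cast
  ring

lemma Top_planewave (j : Fin S.n) (μ : V) (h : qq μ (S.simple j) ≠ 1) :
    S.Top j.succ (S.planewave μ) =
      S.Ac j μ • S.planewave μ + S.Bc j μ • S.planewave (reflP (S.simple j) 0 μ) := by
  ext x
  have hα := simple_R0 (S := S) j
  obtain ⟨k, hk⟩ := x.2 _ hα
  have hq0 := qq_ne μ (S.simple j)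
  have h1 : 1 - qq μ (S.simple j) ≠ 0 := sub_ne_zero.mpr h.symm
  have ha : S.aFun j.succ x.1 = k := by simp [aFun, hk]
  have hs : (S.sgen j.succ)⁻¹ x.1 = x.1 - (k : ℝ) • S.simple j := by
    rw [sgen_succ, reflP_inv, reflP_zero, hk]
  have hp : S.planewave (reflP (S.simple j) 0 μ) x =
      S.planewave μ x * qq μ (S.simple j) ^ k := by
    rw [← ev_shift μ x hα k, ev_mem _ (plat_shift' x.2 hα k)]
    unfold planewave
    simp only
    rw [← hk, ← reflP_zero, real_inner_comm, (good_refl hα).inner_left, reflP_inv,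
      real_inner_comm]
  have hJ : S.Jop j.succ (S.planewave μ) x = S.planewave μ x *
      (-(qq μ (S.simple j) * (1 - qq μ (S.simple j) ^ k) / (1 - qq μ (S.simple j)))) := by
    unfold Jop
    rw [ha, Int.floor_intCast, alpha_succ]
    split_ifs with c1 c2
    · obtain ⟨n, rfl⟩ := Int.eq_ofNat_of_zero_le c1.le
      simp only [ev_shift μ x hα, ← Finset.mul_sum]
      have := geom1 _ h n
      simp only [Int.ofNat_eq_natCast, zpow_natCast] at this ⊢
      rw [this]
      ring
    · obtain ⟨n, hn⟩ := Int.eq_ofNat_of_zero_le (show 0 ≤ -k by omega)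
      have hk' : k = -(n : ℤ) := by omega
      have e : ∀ m : ℤ, S.ev (S.planewave μ) (x.1 + (m : ℝ) • S.simple j) =
          S.planewave μ x * (qq μ (S.simple j))⁻¹ ^ m := by
        intro m
        rw [inv_zpow', ← ev_shift μ x hα (-m), Int.cast_neg, neg_smul, sub_neg_eq_add]
      have hi : (qq μ (S.simple j))⁻¹ ≠ 1 := by
        intro hc; exact h (inv_eq_one.mp hc)
      simp only [e, ← Finset.mul_sum]
      rw [hk', neg_neg, geom0 _ hi n, zpow_neg, zpow_natCast, inv_pow]
      congr 1
      have h2 : qq μ (S.simple j) - 1 ≠ 0 := sub_ne_zero.mpr h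
      have e2 : 1 - (qq μ (S.simple j))⁻¹ = -(1 - qq μ (S.simple j)) / qq μ (S.simple j) := by
        field_simp
        ring
      rw [e2, div_div_eq_mul_div, div_neg]
      ring
    · have : k = 0 := by omega
      simp [this]
  simp only [Top, hs, hJ, alpha_succ, ev_shift μ x hα, Pi.add_apply, Pi.smul_apply, smul_eq_mul,
    hp]
  unfold Ac Bc
  field_simp
  ring

end Setup

namespace Setup
variable {S : Setup V}

variable (S) in
instance fintypeW0 : Fintype ↥S.W0 := Set.Finite.fintype S.W0_finite

variable (S) in
/-- Regular vectors. -/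
def Reg (ξ : V) : Prop := ∀ α ∈ S.R0, qq ξ α ≠ 1

lemma Reg.good {ξ : V} (h : S.Reg ξ) {w : Equiv.Perm V} (hw : S.Good w) {α : V}
    (hα : α ∈ S.R0) : qq (w ξ) α ≠ 1 := by
  have h1 := h _ (hw.inv_mem α hα)
  rw [← qq_good hw] at h1
  simpa using h1

variable (S) in
/-- The simple reflection as an element of `W₀`. -/
def sj (j : Fin S.n) : ↥S.W0 := ⟨reflP (S.simple j) 0, refl_mem_W0 (simple_R0 j)⟩

lemma sj_coe (j : Fin S.n) (w : ↥S.W0) :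
    ((S.sj j * w : ↥S.W0) : Equiv.Perm V) = reflP (S.simple j) 0 * w.1 := rfl

lemma sj_sj (j : Fin S.n) (w : ↥S.W0) : S.sj j * (S.sj j * w) = w := by
  apply Subtype.ext
  exact refl_refl_mul _ _

lemma sj_app (j : Fin S.n) (w : ↥S.W0) (ξ : V) :
    (S.sj j * w : ↥S.W0).1 ξ = reflP (S.simple j) 0 (w.1 ξ) := rfl

variable (S) in
/-- Superposition of plane waves. -/
def Phi (ξ : V) (d : ↥S.W0 → ℂ) : ↥S.Plat → ℂ := ∑ w : ↥S.W0, d w • S.planewave (w.1 ξ)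

variable (S) in
/-- The operator on coefficients. -/
def Hat (ξ : V) (j : Fin S.n) : (↥S.W0 → ℂ) →ₗ[ℂ] (↥S.W0 → ℂ) where
  toFun d w := S.Ac j (w.1 ξ) * d w + S.Bc j ((S.sj j * w).1 ξ) * d (S.sj j * w)
  map_add' d e := by ext w; simp; ring
  map_smul' a d := by ext w; simp; ring

lemma Hat_apply (ξ : V) (j : Fin S.n) (d : ↥S.W0 → ℂ) (w : ↥S.W0) :
    S.Hat ξ j d w = S.Ac j (w.1 ξ) * d w + S.Bc j ((S.sj j * w).1 ξ) * d (S.sj j * w) := rfl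

lemma Top_Phi {ξ : V} (h : S.Reg ξ) (j : Fin S.n) (d : ↥S.W0 → ℂ) :
    S.Top j.succ (S.Phi ξ d) = S.Phi ξ (S.Hat ξ j d) := by
  unfold Phi
  rw [← TopL_apply, map_sum]
  simp only [map_smul, TopL_apply]
  have e : ∀ w : ↥S.W0, S.Top j.succ (S.planewave (w.1 ξ)) = S.Ac j (w.1 ξ) • S.planewave (w.1 ξ) +
      S.Bc j (w.1 ξ) • S.planewave ((S.sj j * w).1 ξ) := fun w =>
    Top_planewave j _ (h.good (good_of_mem w.2) (simple_R0 j))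
  simp only [e, Hat_apply, smul_add, add_smul, Finset.sum_add_distrib, smul_smul]
  congr 1
  · exact Finset.sum_congr rfl fun w _ => by rw [mul_comm]
  · rw [← Equiv.sum_comp (Equiv.mulLeft (S.sj j))]
    apply Finset.sum_congr rfl
    intro w _
    simp only [Equiv.coe_mulLeft]
    rw [sj_sj, mul_comm]

lemma Hat_quad {ξ : V} (h : S.Reg ξ) (j : Fin S.n) (d : ↥S.W0 → ℂ) :
    S.Hat ξ j (S.Hat ξ j d) =
      ((S.t (S.simple j) : ℂ) - 1) • S.Hat ξ j d + (S.t (S.simple j) : ℂ) • d := by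
  ext w
  have h1 := h.good (good_of_mem w.2) (simple_R0 (S := S) j)
  have h2 := h.good (good_of_mem (S.sj j * w).2) (simple_R0 (S := S) j)
  have a1 := Ac_add j _ h1
  have a2 := Ac_add j _ h2
  have a3 := Ac_refl j _ h1
  rw [← sj_app] at a3
  simp only [Hat_apply, Pi.add_apply, Pi.smul_apply, smul_eq_mul, sj_sj]
  have b1 := eq_sub_of_add_eq' a1
  have b2 := eq_sub_of_add_eq' a2
  have b3 := eq_sub_of_add_eq' a3
  rw [b2, b1, b3]
  ring

variable (S) in
/-- Coefficients of `T_{j₁}⋯T_{j_ℓ} e^{iξ}`. -/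
def wordD (ξ : V) : List (Fin S.n) → (↥S.W0 → ℂ)
  | [] => fun w => if w = 1 then 1 else 0
  | j :: l => S.Hat ξ j (wordD ξ l)

lemma wordOp_Phi {ξ : V} (h : S.Reg ξ) (l : List (Fin S.n)) :
    S.wordOp (l.map Fin.succ) (S.planewave ξ) = S.Phi ξ (S.wordD ξ l) := by
  induction l with
  | nil => simp [wordOp, Phi, wordD]
  | cons j l ih =>
    rw [wordD, ← Top_Phi h, ← ih]
    rfl

lemma inv_wp_le (l : List (Fin S.n)) : S.inv (S.wp l) ≤ l.length := by
  have := inv_le_length (wp_mem l) (l.map Fin.succ) (prod_succ l)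
  simpa using this

lemma reduced_tail {j : Fin S.n} {l : List (Fin S.n)} (h : (j :: l).length = S.inv (S.wp (j :: l))) :
    l.length = S.inv (S.wp l) ∧ (S.wp l)⁻¹ (S.simple j) ∈ S.Rpos := by
  have h1 := inv_wp_le l
  rw [wp_cons, List.length_cons] at h
  by_cases hc : (S.wp l)⁻¹ (S.simple j) ∈ S.Rpos
  · have := inv_up (wp_mem l) j hc
    exact ⟨by omega, hc⟩
  · have := inv_down (wp_mem l) j hc
    omega

lemma inv_step {w : Equiv.Perm V} (hw : w ∈ S.W0) (j : Fin S.n) :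
    S.inv w ≤ S.inv (reflP (S.simple j) 0 * w) + 1 := by
  by_cases hc : w⁻¹ (S.simple j) ∈ S.Rpos
  · have := inv_up hw j hc
    omega
  · have := inv_down hw j hc
    omega

variable (S) in
/-- The leading coefficient. -/
def Kc (ξ : V) (w : Equiv.Perm V) : ℂ := ∏ α ∈ S.InvS w, S.cc α (w ξ)

lemma Kc_up {ξ : V} (h : S.Reg ξ) {w : Equiv.Perm V} (hw : w ∈ S.W0) (j : Fin S.n)
    (hj : w⁻¹ (S.simple j) ∈ S.Rpos) :
    S.Kc ξ (reflP (S.simple j) 0 * w) = S.Bc j (w ξ) * S.Kc ξ w := by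
  unfold Kc
  rw [Inv_up hw j hj, Finset.prod_insert (Inv_up_notMem j),
    Finset.prod_image (fun a _ b _ hab => (reflP (S.simple j) 0).injective hab),
    Bc_eq_cc j _ (h.good (good_of_mem hw) (simple_R0 j))]
  congr 1
  apply Finset.prod_congr rfl
  intro β hβ
  exact cc_good (good_refl (simple_R0 j)) (S.pos_subset (mem_Inv.mp hβ).1) _

lemma wordD_tri {ξ : V} (h : S.Reg ξ) (l : List (Fin S.n)) (hl : l.length = S.inv (S.wp l)) :
    (∀ w : ↥S.W0, l.length ≤ S.inv w.1 → w.1 ≠ S.wp l → S.wordD ξ l w = 0) ∧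
    (∀ w : ↥S.W0, w.1 = S.wp l → S.wordD ξ l w = S.Kc ξ w.1) := by
  induction l with
  | nil =>
    constructor
    · intro w _ hne
      have : w ≠ 1 := fun hc => hne (by rw [hc]; rfl)
      simp [wordD, this]
    · intro w hw
      have : w = 1 := Subtype.ext hw
      subst this
      have : S.InvS (1 : Equiv.Perm V) = ∅ := by
        ext α; simp only [mem_Inv]; simp
      simp [wordD, Kc, this]
  | cons j l ih =>
    obtain ⟨h1, h2⟩ := reduced_tail hl
    obtain ⟨i1, i2⟩ := ih h1
    have hup := inv_up (wp_mem l) j h2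
    constructor
    · intro w hle hne
      rw [List.length_cons] at hle
      rw [wordD, Hat_apply, i1 w (by omega) (by intro hc; rw [hc] at hle; omega),
        i1 (S.sj j * w), mul_zero, mul_zero, add_zero]
      · have := inv_step w.2 j
        rw [sj_coe]
        omega
      · intro hc
        apply hne
        rw [wp_cons, ← hc, sj_coe, refl_refl_mul]
    · intro w hw
      rw [wp_cons] at hw
      have e : (S.sj j * w : ↥S.W0).1 = S.wp l := by rw [sj_coe, hw, refl_refl_mul]
      rw [wordD, Hat_apply, i1 w (by rw [hw]; omega), i2 _ e, mul_zero, zero_add, hw, e,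
        Kc_up h (wp_mem l) j h2]
      intro hc
      rw [← hw, hc] at hup
      omega

variable (S) in
/-- Generic vectors. -/
def Gen (ξ : V) : Prop := ∀ α ∈ S.R0, ∀ β ∈ S.R0, α ≠ β → qq ξ (α - β) ≠ 1

lemma qq_add (ξ α β : V) : qq ξ (α + β) = qq ξ α * qq ξ β := by
  unfold qq
  rw [← Complex.exp_add, inner_add_right]
  congr 1
  push_cast
  ring

lemma Gen.reg {ξ : V} (h : S.Gen ξ) : S.Reg ξ := by
  intro α hα hc
  have h1 := h α hα (-α) (neg_mem hα) (by
    intro hc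
    have h2 : (2 : ℝ) • α = 0 := by
      rw [two_smul]
      nth_rewrite 1 [hc]
      simp
    exact root_ne hα ((smul_eq_zero.mp h2).resolve_left two_ne_zero))
  apply h1
  rw [sub_neg_eq_add, qq_add, hc, mul_one]

variable (S) in
/-- The weight lattice as a subgroup. -/
def PlatA : AddSubgroup V where
  carrier := S.Plat
  zero_mem' := fun α _ => ⟨0, by simp⟩
  add_mem' := by
    intro a b ha hb α hα
    obtain ⟨m, hm⟩ := ha α hα
    obtain ⟨n, hn⟩ := hb α hα
    exact ⟨m + n, by rw [inner_add_left, hm, hn]; push_cast; rfl⟩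
  neg_mem' := by
    intro a ha α hα
    obtain ⟨m, hm⟩ := ha α hα
    exact ⟨-m, by rw [inner_neg_left, hm]; push_cast; rfl⟩

variable (S) in
/-- Plane waves as characters. -/
def chr (μ : V) : Multiplicative ↥S.PlatA →* ℂ where
  toFun x := S.planewave μ (Multiplicative.toAdd x)
  map_one' := by
    change Complex.exp (Complex.I * ((⟪(0 : V), μ⟫ : ℝ) : ℂ)) = 1
    simp
  map_mul' x y := by
    change Complex.exp (Complex.I * ((⟪(Multiplicative.toAdd x).1 + (Multiplicative.toAdd y).1, μ⟫ : ℝ) : ℂ)) = Complex.exp (Complex.I * ((⟪(Multiplicative.toAdd x).1, μ⟫ : ℝ) : ℂ)) * Complex.exp (Complex.I * ((⟪(Multiplicative.toAdd y).1, μ⟫ : ℝ) : ℂ))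
    rw [← Complex.exp_add, inner_add_left]
    congr 1
    push_cast
    ring

lemma chr_inj {ξ : V} (h : S.Gen ξ) : Function.Injective fun w : ↥S.W0 => S.chr (w.1 ξ) := by
  intro w w' hww
  have key : ∀ α ∈ S.R0, w.1⁻¹ α = w'.1⁻¹ α := by
    intro α hα
    by_contra hne
    have g := good_of_mem w.2
    have g' := good_of_mem w'.2
    apply h _ (g.inv_mem α hα) _ (g'.inv_mem α hα) hne
    have e1 := DFunLike.congr_fun hww (Multiplicative.ofAdd (⟨α, fun β hβ => S.cryst β hβ α hα⟩ : ↥S.PlatA))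
    change Complex.exp (Complex.I * ((⟪α, w.1 ξ⟫ : ℝ) : ℂ)) =
      Complex.exp (Complex.I * ((⟪α, w'.1 ξ⟫ : ℝ) : ℂ)) at e1
    have f1 : ⟪ξ, w.1⁻¹ α⟫ = ⟪α, w.1 ξ⟫ := by rw [← g.inner_left, real_inner_comm]
    have f2 : ⟪ξ, w'.1⁻¹ α⟫ = ⟪α, w'.1 ξ⟫ := by rw [← g'.inner_left, real_inner_comm]
    unfold qq
    rw [inner_sub_right, f1, f2]
    have : -(Complex.I * ((⟪α, w.1 ξ⟫ - ⟪α, w'.1 ξ⟫ : ℝ) : ℂ)) =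
      Complex.I * ((⟪α, w'.1 ξ⟫ : ℝ) : ℂ) - Complex.I * ((⟪α, w.1 ξ⟫ : ℝ) : ℂ) := by
      push_cast; ring
    rw [this, Complex.exp_sub, e1, div_self (Complex.exp_ne_zero _)]
  have h2 : w.1⁻¹ = w'.1⁻¹ := by
    have g := (good_of_mem w.2).inv
    have g' := (good_of_mem w'.2).inv
    ext x
    have hx : x ∈ Submodule.span ℝ (S.R0 : Set V) := by rw [S.span_top]; trivial
    induction hx using Submodule.span_induction with
    | mem x hx => exact key x hx
    | zero =>
      have z1 := g.smul 0 0
      have z2 := g'.smul 0 0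
      simp only [zero_smul] at z1 z2
      rw [z1, z2]
    | add x y _ _ hx hy => rw [g.add, g'.add, hx, hy]
    | smul r x _ hx => rw [g.smul, g'.smul, hx]
  exact Subtype.ext (inv_injective h2)

lemma Phi_inj {ξ : V} (h : S.Gen ξ) {d e : ↥S.W0 → ℂ} (hde : S.Phi ξ d = S.Phi ξ e) : d = e := by
  have li := (linearIndependent_monoidHom (Multiplicative ↥S.PlatA) ℂ).comp _ (chr_inj h)
  rw [Fintype.linearIndependent_iff] at li
  have := li (d - e) (by
    ext x
    have h1 := congrFun hde (Multiplicative.toAdd x)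
    unfold Phi at h1
    simp only [Finset.sum_apply, Pi.smul_apply, smul_eq_mul] at h1
    have h2 : ∀ w : ↥S.W0, (S.chr (w.1 ξ)) x = S.planewave (w.1 ξ) (Multiplicative.toAdd x) :=
      fun w => rfl
    simp only [Finset.sum_apply, Pi.smul_apply, smul_eq_mul, Function.comp, Pi.sub_apply, sub_mul,
      Finset.sum_sub_distrib, Pi.zero_apply, h2]
    rw [sub_eq_zero]
    exact h1)
  ext w
  exact sub_eq_zero.mp (this w)

lemma Cfun_rel {μ : V} (h : S.Reg μ) (j : Fin S.n) :
    S.Bc j (reflP (S.simple j) 0 μ) * S.Cfun (reflP (S.simple j) 0 μ) = S.Bc j μ * S.Cfun μ := by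
  have hg := good_refl (S := S) (simple_R0 j)
  have hR : ∏ β ∈ S.Rpos.erase (S.simple j), S.cc β (reflP (S.simple j) 0 μ) =
      ∏ β ∈ S.Rpos.erase (S.simple j), S.cc β μ := by
    have hm : ∀ β ∈ S.Rpos.erase (S.simple j),
        reflP (S.simple j) 0 β ∈ S.Rpos.erase (S.simple j) := by
      intro β hβ
      rw [Finset.mem_erase] at hβ ⊢
      refine ⟨?_, simple_refl_pos j hβ.2 hβ.1⟩
      intro hc
      have := congrArg (reflP (S.simple j) 0) hc
      rw [reflP_reflP, simple_refl_self] at this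
      exact neg_not_mem_pos (S.simple_mem j) (this ▸ hβ.2)
    apply Finset.prod_bij' (fun β _ => reflP (S.simple j) 0 β) (fun β _ => reflP (S.simple j) 0 β)
      hm hm (fun β _ => reflP_reflP _ _ _) (fun β _ => reflP_reflP _ _ _)
    intro β hβ
    have := cc_good hg (S.pos_subset (Finset.mem_of_mem_erase hβ)) (reflP (S.simple j) 0 μ)
    rw [reflP_reflP] at this
    exact this.symm
  rw [Bc_eq_cc j _ (h.good hg (simple_R0 j)), Bc_eq_cc j _ (h _ (simple_R0 j)), reflP_reflP,
    Cfun_eq, Cfun_eq, ← Finset.mul_prod_erase _ _ (S.simple_mem j),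
    ← Finset.mul_prod_erase _ (fun α => S.cc α μ) (S.simple_mem j), hR]
  ring

lemma Reg.map {ξ : V} (h : S.Reg ξ) {w : Equiv.Perm V} (hw : S.Good w) : S.Reg (w ξ) :=
  fun _ hα => h.good hw hα

/-- The plane-wave decomposition for generic `ξ`. -/
lemma generic_main {ξ : V} (h : S.Gen ξ) (l : ↥S.W0 → List (Fin S.n))
    (hl1 : ∀ w, S.wp (l w) = w.1) (hl2 : ∀ w, (l w).length = S.inv w.1)
    (hT : ∀ (w : ↥S.W0) (m : List (Fin S.n)), S.wp m = w.1 → m.length = S.inv w.1 →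
      S.wordOp (m.map Fin.succ) = S.wordOp ((l w).map Fin.succ)) :
    ∑ w : ↥S.W0, S.wordOp ((l w).map Fin.succ) (S.planewave ξ) =
      ∑ w : ↥S.W0, S.Cfun (w.1 ξ) • S.planewave (w.1 ξ) := by
  have hr := h.reg
  set D : ↥S.W0 → ↥S.W0 → ℂ := fun w => S.wordD ξ (l w) with hD
  have hup : ∀ (j : Fin S.n) (w : ↥S.W0), w.1⁻¹ (S.simple j) ∈ S.Rpos →
      S.Hat ξ j (D w) = D (S.sj j * w) := by
    intro j w hw
    have h1 := inv_up w.2 j hw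
    have h2 := hT (S.sj j * w) (j :: l w) (by rw [wp_cons, hl1]; rfl) (by
      rw [List.length_cons, hl2, sj_coe, h1])
    apply Phi_inj h
    rw [hD]
    simp only
    rw [← wordOp_Phi hr, ← h2, wordOp_Phi hr]
    rfl
  have hpair : ∀ (j : Fin S.n) (w : ↥S.W0), S.Hat ξ j (D w + D (S.sj j * w)) =
      (S.t (S.simple j) : ℂ) • (D w + D (S.sj j * w)) := by
    have hp : ∀ (j : Fin S.n) (w : ↥S.W0), w.1⁻¹ (S.simple j) ∈ S.Rpos →
        S.Hat ξ j (D w + D (S.sj j * w)) =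
        (S.t (S.simple j) : ℂ) • (D w + D (S.sj j * w)) := by
      intro j w hw
      rw [map_add, ← hup j w hw, Hat_quad hr]
      module
    intro j w
    by_cases hc : w.1⁻¹ (S.simple j) ∈ S.Rpos
    · exact hp j w hc
    · have := hp j (S.sj j * w) (up_of_down w.2 j hc)
      rwa [sj_sj, add_comm] at this
  set T : ↥S.W0 → ℂ := ∑ w, D w with hTd
  have hHT : ∀ j, S.Hat ξ j T = (S.t (S.simple j) : ℂ) • T := by
    intro j
    have e1 : ∑ w, D (S.sj j * w) = T := Equiv.sum_comp (Equiv.mulLeft (S.sj j)) D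
    have e2 : ∑ w, (D w + D (S.sj j * w)) = T + T := by
      rw [Finset.sum_add_distrib, e1]
    have e3 : S.Hat ξ j (T + T) = (S.t (S.simple j) : ℂ) • (T + T) := by
      rw [← e2, map_sum, Finset.smul_sum]
      exact Finset.sum_congr rfl fun w _ => hpair j w
    rw [map_add, smul_add, ← two_smul ℂ, ← two_smul ℂ (_ • T)] at e3
    exact smul_right_injective _ (two_ne_zero) e3
  have hrel : ∀ j (w : ↥S.W0), S.Bc j ((S.sj j * w).1 ξ) * T (S.sj j * w) =
      S.Bc j (w.1 ξ) * T w := by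
    intro j w
    have e := congrFun (hHT j) w
    rw [Hat_apply, Pi.smul_apply, smul_eq_mul,
      ← Ac_add j (w.1 ξ) (hr.good (good_of_mem w.2) (simple_R0 j))] at e
    linear_combination e
  set Z : ↥S.W0 → ℂ := fun w => T w - S.Cfun (w.1 ξ) with hZ
  have hZrel : ∀ j (w : ↥S.W0), Z w = 0 → Z (S.sj j * w) = 0 := by
    intro j w hw
    have e1 := hrel j w
    have e2 := Cfun_rel (hr.map (good_of_mem w.2)) j
    rw [← sj_app] at e2
    have hb := Bc_ne j _ (hr.good (good_of_mem (S.sj j * w).2) (simple_R0 j))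
    have : S.Bc j ((S.sj j * w).1 ξ) * Z (S.sj j * w) = 0 := by
      simp only [hZ] at hw ⊢
      linear_combination e1 - e2 + S.Bc j (w.1 ξ) * hw
    exact (mul_eq_zero.mp this).resolve_left hb
  obtain ⟨w0, hw0, hinv⟩ := S.exists_longest
  have hcard : S.inv w0 = S.Rpos.card := by rw [inv, hinv]
  have hZ0 : Z ⟨w0, hw0⟩ = 0 := by
    simp only [hZ, hTd, Finset.sum_apply]
    rw [sub_eq_zero, Finset.sum_eq_single ⟨w0, hw0⟩]
    · rw [hD]
      simp only
      rw [(wordD_tri hr _ (by rw [hl1, hl2])).2 _ (by rw [hl1]), Kc, hinv]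
      rfl
    · intro v _ hv
      refine (wordD_tri hr _ (by rw [hl1, hl2])).1 _ ?_ ?_
      · rw [hl2, hcard]; exact inv_le _
      · rw [hl1]
        intro hc
        exact hv (Subtype.ext hc.symm)
    · intro hc; exact absurd (Finset.mem_univ _) hc
  have hword : ∀ (m : List (Fin S.n)) (w : ↥S.W0), Z w = 0 → Z (⟨S.wp m, wp_mem m⟩ * w) = 0 := by
    intro m
    induction m with
    | nil => intro w hw; exact hw
    | cons j m ih =>
      intro w hw
      have := hZrel j _ (ih w hw)
      rw [← mul_assoc] at this
      exact this
  have hall : ∀ w, Z w = 0 := by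
    intro w
    obtain ⟨m, hm⟩ := exists_word (w * (⟨w0, hw0⟩ : ↥S.W0)⁻¹).2
    have := hword m _ hZ0
    convert this using 2
    have e : (⟨S.wp m, wp_mem m⟩ : ↥S.W0) = w * (⟨w0, hw0⟩ : ↥S.W0)⁻¹ := Subtype.ext hm
    rw [e, inv_mul_cancel_right]
  have e1 : ∑ w : ↥S.W0, S.wordOp ((l w).map Fin.succ) (S.planewave ξ) = S.Phi ξ T := by
    simp only [wordOp_Phi hr]
    unfold Phi
    rw [Finset.sum_comm]
    apply Finset.sum_congr rfl
    intro w _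
    rw [hTd, Finset.sum_apply, Finset.sum_smul]
  rw [e1]
  unfold Phi
  apply Finset.sum_congr rfl
  intro w _
  rw [sub_eq_zero.mp (hall w)]

end Setup

namespace Setup
variable {S : Setup V}

lemma Top_cont (j : Fin (S.n + 1)) (f : ℝ → ↥S.Plat → ℂ) (hf : ∀ x, Continuous fun s => f s x)
    (x : ↥S.Plat) : Continuous fun s => S.Top j (f s) x := by
  have hev : ∀ y, Continuous fun s => S.ev (f s) y := by
    intro y
    unfold ev
    split_ifs with h
    · exact hf _
    · exact continuous_const
  unfold Top Jop
  refine (continuous_const.mul (hev _)).add (continuous_const.mul ?_)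
  split_ifs
  · exact (continuous_finset_sum _ fun k _ => hev _).neg
  · exact continuous_finset_sum _ fun k _ => hev _
  · exact continuous_const

lemma wordOp_cont (l : List (Fin (S.n + 1))) (f : ℝ → ↥S.Plat → ℂ)
    (hf : ∀ x, Continuous fun s => f s x) :
    ∀ x, Continuous fun s => S.wordOp l (f s) x := by
  induction l with
  | nil => exact hf
  | cons j l ih => exact fun x => Top_cont j (fun s => S.wordOp l (f s)) ih x

variable (S) in
lemma exists_dir : ∃ η : V, ∀ α ∈ S.R0, ∀ β ∈ S.R0, α ≠ β → ⟪η, α - β⟫ ≠ 0 := by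
  obtain ⟨η, hη⟩ := Module.Dual.exists_forall_ne_zero_of_forall_exists
    (fun i : {p : ↥S.R0 × ↥S.R0 // p.1 ≠ p.2} => innerₗ V (i.1.1.1 - i.1.2.1)) (by
      rintro ⟨⟨a, b⟩, hab⟩
      refine ⟨a.1 - b.1, ?_⟩
      rw [innerₗ_apply_apply]
      intro hc
      exact hab (Subtype.ext (sub_eq_zero.mp (inner_self_eq_zero.mp hc))))
  refine ⟨η, fun α hα β hβ hne => ?_⟩
  have := hη ⟨(⟨α, hα⟩, ⟨β, hβ⟩), fun hc => hne (congrArg Subtype.val hc)⟩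
  rw [innerₗ_apply_apply, real_inner_comm] at this
  exact this

lemma gen_dense {ξ η : V} (hη : ∀ α ∈ S.R0, ∀ β ∈ S.R0, α ≠ β → ⟪η, α - β⟫ ≠ 0) :
    Dense {s : ℝ | S.Gen (ξ + s • η)} := by
  have hc : ({s : ℝ | S.Gen (ξ + s • η)}ᶜ).Countable := by
    have hsub : {s : ℝ | S.Gen (ξ + s • η)}ᶜ ⊆ ⋃ p : ↥S.R0 × ↥S.R0, ⋃ k : ℤ,
        {s : ℝ | p.1 ≠ p.2 ∧ ⟪ξ + s • η, p.1.1 - p.2.1⟫ = 2 * Real.pi * k} := by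
      intro s hs
      simp only [Set.mem_compl_iff, Set.mem_setOf_eq, Gen] at hs
      push Not at hs
      obtain ⟨α, hα, β, hβ, hne, h1⟩ := hs
      obtain ⟨k, hk⟩ := (qq_eq_one _ _).mp h1
      simp only [Set.mem_iUnion]
      exact ⟨(⟨α, hα⟩, ⟨β, hβ⟩), k, fun hc => hne (congrArg Subtype.val hc), hk⟩
    refine Set.Countable.mono hsub ?_
    refine Set.countable_iUnion fun p => Set.countable_iUnion fun k => ?_
    apply Set.Subsingleton.countable
    rintro s ⟨h1, h2⟩ s' ⟨_, h3⟩
    have h4 := hη _ p.1.2 _ p.2.2 (fun hc => h1 (Subtype.ext hc))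
    rw [inner_add_left, real_inner_smul_left] at h2 h3
    have : s * ⟪η, p.1.1 - p.2.1⟫ = s' * ⟪η, p.1.1 - p.2.1⟫ := by linarith
    exact mul_right_cancel₀ h4 this
  have := hc.dense_compl ℝ
  rwa [compl_compl] at this

lemma Cfun_cont {ξ η : V} (h : S.Reg ξ) {w : Equiv.Perm V} (hw : S.Good w) :
    ContinuousAt (fun s : ℝ => S.Cfun (w (ξ + s • η))) 0 := by
  have hq : ∀ α, Continuous fun s : ℝ => qq (w (ξ + s • η)) α := by
    intro α
    simp only [hw.add, hw.smul]
    unfold qq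
    fun_prop
  simp only [Cfun_eq]
  apply tendsto_finset_prod
  intro α hα
  unfold cc
  refine ContinuousAt.div ?_ ?_ ?_
  · exact (continuous_const.sub (continuous_const.mul (hq α))).continuousAt
  · exact (continuous_const.sub (hq α)).continuousAt
  · rw [zero_smul, add_zero]
    exact sub_ne_zero.mpr (h.good hw (S.pos_subset hα)).symm

lemma planewave_cont {ξ η : V} {w : Equiv.Perm V} (hw : S.Good w) (x : ↥S.Plat) :
    Continuous (fun s : ℝ => S.planewave (w (ξ + s • η)) x) := by
  simp only [hw.add, hw.smul]
  unfold planewave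
  fun_prop

lemma regular_main {ξ : V} (h : S.Reg ξ) (l : ↥S.W0 → List (Fin S.n))
    (hl1 : ∀ w, S.wp (l w) = w.1) (hl2 : ∀ w, (l w).length = S.inv w.1)
    (hT : ∀ (w : ↥S.W0) (m : List (Fin S.n)), S.wp m = w.1 → m.length = S.inv w.1 →
      S.wordOp (m.map Fin.succ) = S.wordOp ((l w).map Fin.succ)) (x : ↥S.Plat) :
    ∑ w : ↥S.W0, S.wordOp ((l w).map Fin.succ) (S.planewave ξ) x =
      ∑ w : ↥S.W0, S.Cfun (w.1 ξ) * S.planewave (w.1 ξ) x := by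
  obtain ⟨η, hη⟩ := S.exists_dir
  have hL : ContinuousAt (fun s : ℝ => ∑ w : ↥S.W0, S.wordOp ((l w).map Fin.succ)
      (S.planewave (ξ + s • η)) x) 0 := by
    apply Continuous.continuousAt
    refine continuous_finset_sum _ fun w _ => ?_
    exact wordOp_cont _ (fun s => S.planewave (ξ + s • η))
      (fun y => planewave_cont (w := 1) Good.one y) x
  have hR : ContinuousAt (fun s : ℝ => ∑ w : ↥S.W0, S.Cfun (w.1 (ξ + s • η)) *
      S.planewave (w.1 (ξ + s • η)) x) 0 := by
    apply tendsto_finset_sum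
    intro w _
    exact (Cfun_cont h (good_of_mem w.2)).mul (planewave_cont (good_of_mem w.2) x).continuousAt
  have hfr : ∃ᶠ s in nhds (0 : ℝ), (∑ w : ↥S.W0, S.wordOp ((l w).map Fin.succ)
      (S.planewave (ξ + s • η)) x) = ∑ w : ↥S.W0, S.Cfun (w.1 (ξ + s • η)) *
      S.planewave (w.1 (ξ + s • η)) x := by
    have := mem_closure_iff_frequently.mp (gen_dense (ξ := ξ) hη 0)
    refine this.mono fun s hs => ?_
    have := congrFun (generic_main hs l hl1 hl2 hT) x
    simpa only [Finset.sum_apply, Pi.smul_apply, smul_eq_mul] using this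
  have := tendsto_nhds_unique_of_frequently_eq hL hR hfr
  simpa only [zero_smul, add_zero] using this

lemma statement_aux (TW : Equiv.Perm V → (↥S.Plat → ℂ) → (↥S.Plat → ℂ)) (hTW : S.IsTW TW)
    (ξ : V) (hreg : ∀ α ∈ S.Rpos, ¬ ∃ k : ℤ, ⟪ξ, α⟫ = 2 * Real.pi * (k : ℝ)) (lam : ↥S.Plat) :
      S.phiW TW ξ lam = ∑ᶠ w ∈ (S.W0 : Set (Equiv.Perm V)),
        S.Cfun (w ξ) * Complex.exp (Complex.I * (⟪w ξ, lam.1⟫ : ℂ)) := by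
  have h : S.Reg ξ := by
    intro α hα hc
    by_cases hp : α ∈ S.Rpos
    · exact hreg α hp ((qq_eq_one _ _).mp hc)
    · apply hreg _ (neg_mem_pos hα hp)
      rw [← qq_eq_one, qq_neg, hc, inv_one]
  have hex : ∀ w : ↥S.W0, ∃ l, S.wp l = w.1 ∧ l.length = S.inv w.1 := fun w => exists_reduced w.2
  choose l hl1 hl2 using hex
  have hw : ∀ w : ↥S.W0, TW w.1 = S.wordOp ((l w).map Fin.succ) := fun w =>
    hTW _ _ (isReduced_succ (hl1 w) (hl2 w))
  have main := regular_main h l hl1 hl2 (by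
    intro w m h1 h2
    rw [← hw, hTW _ _ (isReduced_succ h1 h2)]) lam
  have c1 : ∀ {M : Type} [AddCommMonoid M] (F : Equiv.Perm V → M),
      ∑ᶠ w ∈ (S.W0 : Set (Equiv.Perm V)), F w = ∑ w : ↥S.W0, F w.1 := by
    intro M _ F
    rw [← finsum_eq_sum_of_fintype]
    exact (finsum_set_coe_eq_finsum_mem (S.W0 : Set (Equiv.Perm V))).symm
  have c2 : S.phiW TW ξ = ∑ w : ↥S.W0, TW w.1 (S.planewave ξ) := by
    unfold phiW
    rw [← finsum_eq_sum_of_fintype]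
    exact (finsum_set_coe_eq_finsum_mem (S.W0 : Set (Equiv.Perm V))).symm
  rw [c1, c2, Finset.sum_apply]
  simp only [hw]
  rw [main]
  apply Finset.sum_congr rfl
  intro w _
  unfold planewave
  rw [real_inner_comm]

end Setup

/-- plane-wave decomposition of `φ_ξ = ∑_{v∈W₀} T_v e^{iξ}` for regular
`ξ`; in particular `φ_ξ(λ) = M_λ(ξ)` for all dominant weights `λ`. -/
theorem statement7 (S : Setup V) (htne : ∀ α ∈ S.R0, S.t α ≠ 0)
    (TW : Equiv.Perm V → (↥S.Plat → ℂ) → (↥S.Plat → ℂ)) (hTW : S.IsTW TW)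
    (ξ : V) (hreg : ∀ α ∈ S.Rpos, ¬ ∃ k : ℤ, ⟪ξ, α⟫ = 2 * Real.pi * (k : ℝ)) :
    (∀ lam : ↥S.Plat,
      S.phiW TW ξ lam = ∑ᶠ w ∈ (S.W0 : Set (Equiv.Perm V)),
        S.Cfun (w ξ) * Complex.exp (Complex.I * (⟪w ξ, lam.1⟫ : ℂ))) ∧
    (∀ lam : ↥S.Plat, lam.1 ∈ S.Pplus → S.phiW TW ξ lam = S.Msph lam.1 ξ) := by
  refine ⟨fun lam => Setup.statement_aux TW hTW ξ hreg lam, fun lam _ => ?_⟩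
  exact Setup.statement_aux TW hTW ξ hreg lam

end AffinePieri
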